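/- arXiv:math/0208107 — 2 statements merged into one kernel-verified Lean document; each statement's English description precedes it below -/
import Mathlib

section
/- For any partitions λ, μ, ν with at most r parts and any positive integer N, the Littlewood–Richardson coefficient c^λ_{μ,ν} is nonzero if and only if c^{Nλ}_{Nμ,Nν} is nonzero. -/
noncomputable section

open Module Submodule

/-! ### Polynomial functions and the Zariski topology on a vector space -/

/-- Evaluation of a polynomial in linear functionals at a point of a vector space.
These are exactly the polynomial functions on a finite-dimensional vector space. -/
def mEval (k : Type*) {M : Type*} [Field k] [AddCommGroup M] [Module k M]
    (x : M) (p : MvPolynomial (Module.Dual k M) k) : k :=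
  MvPolynomial.eval (fun l : Module.Dual k M => l x) p

/-- The Zariski topology on a (finite-dimensional) vector space, generated by the
complements of zero sets of polynomial functions. -/
def mZariski (k M : Type*) [Field k] [AddCommGroup M] [Module k M] :
    TopologicalSpace M :=
  TopologicalSpace.generateFrom
    {U : Set M | ∃ p : MvPolynomial (Module.Dual k M) k, U = {x : M | mEval k x p ≠ 0}}

/-- The Zariski tangent space at a point `x` to a subset `A` of a vector space:
the common kernel of the differentials at `x` of all polynomial functions vanishing on `A`. -/
def mTangent (k : Type*) {M : Type*} [Field k] [AddCommGroup M] [Module k M]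
    (A : Set M) (x : M) : Submodule k M :=
  letI := Classical.decEq (Module.Dual k M)
  ⨅ p ∈ {p : MvPolynomial (Module.Dual k M) k | ∀ a ∈ A, mEval k a p = 0},
    LinearMap.ker (∑ l ∈ p.vars, mEval k x (MvPolynomial.pderiv l p) • (l : Module.Dual k M))

/-- `f : M → N` is a polynomial map on a subset `A ⊆ M`. -/
def IsPolyOn (k : Type*) {M N : Type*} [Field k] [AddCommGroup M] [Module k M]
    [AddCommGroup N] [Module k N] (A : Set M) (f : M → N) : Prop :=
  ∀ l : Module.Dual k N, ∃ p : MvPolynomial (Module.Dual k M) k, ∀ x ∈ A, l (f x) = mEval k x p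

/-- Dimension (topological Krull dimension) of a subset of a topological space. -/
def subDim {α : Type*} (t : TopologicalSpace α) (C : Set α) : WithBot ℕ∞ :=
  @topologicalKrullDim C (TopologicalSpace.induced (Subtype.val : C → α) t)

/-- The irreducible components of a subset `A` of a topological space
(for the subspace topology). -/
def subComponents {α : Type*} (t : TopologicalSpace α) (A : Set α) : Set (Set ↥A) :=
  @irreducibleComponents A (TopologicalSpace.induced (Subtype.val : A → α) t)

/-- Dimension of a subset `C` of a subspace `A` of a topological space. -/
def compDim {α : Type*} (t : TopologicalSpace α) (A : Set α) (C : Set ↥A) : WithBot ℕ∞ :=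
  subDim (TopologicalSpace.induced (Subtype.val : A → α) t) C

/-! ### Flags, Schubert cells and Schubert varieties -/

/-- A complete flag on a finite-dimensional vector space, recorded as the increasing
function sending `m` to the `m`-th member (of dimension `m`) of the flag. -/
def IsFlag {k M : Type*} [Field k] [AddCommGroup M] [Module k M]
    (E : ℕ → Submodule k M) : Prop :=
  Monotone E ∧ ∀ m : ℕ, finrank k ↥(E m) = min m (finrank k M)

/-- Membership of `V` in the (open) Schubert cell `Ω°_I(E_•) ⊆ Gr(r, M)` attached to the
subset `I ⊆ [n]` recorded by the strictly increasing tuple `i : Fin r → Fin n`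
(`0`-indexed: the `1`-based subset is `{i a + 1}`): `dim (V ∩ E_u) = #{a | i_a ≤ u}`. -/
def cellMem {k M : Type*} [Field k] [AddCommGroup M] [Module k M] {n r : ℕ}
    (i : Fin r → Fin n) (E : ℕ → Submodule k M) (V : Submodule k M) : Prop :=
  finrank k ↥V = r ∧
    ∀ u : ℕ, u ≤ n →
      finrank k ↥(V ⊓ E u) =
        (Finset.univ.filter (fun a : Fin r => (i a : ℕ) + 1 ≤ u)).card

/-- Membership of `V` in the (closed) Schubert variety `Ω_I(E_•) ⊆ Gr(r, M)`:
`dim (V ∩ E_{i_a}) ≥ a` for `a = 1, …, r`. -/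
def varMem {k M : Type*} [Field k] [AddCommGroup M] [Module k M] {n r : ℕ}
    (i : Fin r → Fin n) (E : ℕ → Submodule k M) (V : Submodule k M) : Prop :=
  finrank k ↥V = r ∧ ∀ a : Fin r, (a : ℕ) + 1 ≤ finrank k ↥(V ⊓ E ((i a : ℕ) + 1))

/-- The flag induced on a subspace `V` by a flag `E` on `M`: its `a`-th member is the
smallest subspace of the form `V ∩ E_u` of dimension `≥ a`. -/
def indSub {k M : Type*} [Field k] [AddCommGroup M] [Module k M]
    (E : ℕ → Submodule k M) (V : Submodule k M) : ℕ → Submodule k ↥V := fun a =>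
  ⨅ u ∈ {u : ℕ | a ≤ finrank k ↥(Submodule.comap V.subtype (E u))},
    Submodule.comap V.subtype (E u)

/-- The flag induced on the quotient `M ⧸ V` by a flag `E` on `M`: its `b`-th member is
the smallest subspace of the form `(E_u + V)/V` of dimension `≥ b`. -/
def indQuot {k M : Type*} [Field k] [AddCommGroup M] [Module k M]
    (E : ℕ → Submodule k M) (V : Submodule k M) : ℕ → Submodule k (M ⧸ V) := fun b =>
  ⨅ u ∈ {u : ℕ | b ≤ finrank k ↥(Submodule.map V.mkQ (E u))},
    Submodule.map V.mkQ (E u)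

/-- The flag spanned by a tuple of vectors (a complete flag when the tuple is a basis). -/
def spanFlag (k : Type*) {M : Type*} [Field k] [AddCommGroup M] [Module k M] {r : ℕ}
    (b : Fin r → M) : ℕ → Submodule k M := fun m =>
  Submodule.span k (b '' {a : Fin r | (a : ℕ) < m})

/-- `P` holds for a generic point of `Fl(M)^s` (`r = dim M`): there is a nonempty Zariski
open set of `s`-tuples of bases of `M` on which the associated tuples of complete flags
satisfy `P`. -/
def GenericFlags (k : Type*) {M : Type*} [Field k] [AddCommGroup M] [Module k M]
    (s r : ℕ) (P : (Fin s → ℕ → Submodule k M) → Prop) : Prop :=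
  ∃ U : Set (Fin s → Fin r → M),
    @IsOpen _ (mZariski k (Fin s → Fin r → M)) U ∧
    (∃ b ∈ U, ∀ j, LinearIndependent k (b j)) ∧
    ∀ b ∈ U, (∀ j, LinearIndependent k (b j)) → P (fun j => spanFlag k (b j))

/-- `P` holds for a generic point of `Fl(M)^s × Fl(Q)^s` (`r = dim M`, `q = dim Q`). -/
def GenericFlagPairs (k : Type*) {M Q : Type*} [Field k] [AddCommGroup M] [Module k M]
    [AddCommGroup Q] [Module k Q] (s r q : ℕ)
    (P : (Fin s → ℕ → Submodule k M) → (Fin s → ℕ → Submodule k Q) → Prop) : Prop :=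
  ∃ U : Set ((Fin s → Fin r → M) × (Fin s → Fin q → Q)),
    @IsOpen _ (mZariski k ((Fin s → Fin r → M) × (Fin s → Fin q → Q))) U ∧
    (∃ b ∈ U, (∀ j, LinearIndependent k (b.1 j)) ∧ ∀ j, LinearIndependent k (b.2 j)) ∧
    ∀ b ∈ U, ((∀ j, LinearIndependent k (b.1 j)) ∧ ∀ j, LinearIndependent k (b.2 j)) →
      P (fun j => spanFlag k (b.1 j)) (fun j => spanFlag k (b.2 j))

/-! ### The spaces `Hom_𝓘(V, Q, 𝓕, 𝓖)` -/

/-- The subspace `{φ : M →ₗ Q | φ(p) ⊆ q}` of `Hom(M, Q)`. -/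
def homConstraint {k M Q : Type*} [Field k] [AddCommGroup M] [Module k M]
    [AddCommGroup Q] [Module k Q] (p : Submodule k M) (q : Submodule k Q) :
    Submodule k (M →ₗ[k] Q) :=
  LinearMap.ker ((LinearMap.llcomp k ↥p Q (Q ⧸ q) q.mkQ).comp (LinearMap.lcomp k Q p.subtype))

/-- `Hom_𝓘(M, Q, F, G) = {φ | φ(F^j_a) ⊆ G^j_{i^j_a - a} for all a = 1, …, r, j = 1, …, s}`. -/
def homSpace {k M Q : Type*} [Field k] [AddCommGroup M] [Module k M]
    [AddCommGroup Q] [Module k Q] {n r s : ℕ} (I : Fin s → Fin r → Fin n)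
    (F : Fin s → ℕ → Submodule k M) (G : Fin s → ℕ → Submodule k Q) :
    Submodule k (M →ₗ[k] Q) :=
  ⨅ j : Fin s, ⨅ a : Fin r,
    homConstraint (F j ((a : ℕ) + 1)) (G j ((I j a : ℕ) - (a : ℕ)))

/-! ### Charts on the Grassmannian, tangent spaces to Schubert cells -/

/-- The graph of `ψ : V →ₗ C`, a point of the Grassmannian chart around `V`
determined by a complement `C` of `V`. -/
def graphMap {k M : Type*} [Field k] [AddCommGroup M] [Module k M]
    (V C : Submodule k M) (ψ : ↥V →ₗ[k] ↥C) : Submodule k M :=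
  LinearMap.range (V.subtype + C.subtype ∘ₗ ψ)

/-- The canonical identification `Hom(V, C) ≃ Hom(V, M/V)` (derivative of the chart). -/
def conjMap {k M : Type*} [Field k] [AddCommGroup M] [Module k M]
    (V C : Submodule k M) : (↥V →ₗ[k] ↥C) →ₗ[k] (↥V →ₗ[k] M ⧸ V) :=
  LinearMap.llcomp k ↥V ↥C (M ⧸ V) (V.mkQ ∘ₗ C.subtype)

/-- The tangent space at `V` to a set `S` of points of the Grassmannian `Gr(r, M)`,
computed in the chart determined by a complement `C` of `V` and viewed inside
`Hom(V, M/V)` via the canonical identification. -/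
def grTangent {k M : Type*} [Field k] [AddCommGroup M] [Module k M]
    (S : Set (Submodule k M)) (V C : Submodule k M) :
    Submodule k (↥V →ₗ[k] (M ⧸ V)) :=
  Submodule.map (conjMap V C)
    (mTangent k {ψ : ↥V →ₗ[k] ↥C | graphMap V C ψ ∈ S} 0)

/-- The Zariski topology on the Grassmannian of `r`-dimensional subspaces of `M`
(as a topology on `Submodule k M`), coinduced from the Stiefel parameterization by
spanning `r`-tuples. -/
def grTop (k : Type*) {M : Type*} [Field k] [AddCommGroup M] [Module k M] (r : ℕ) :
    TopologicalSpace (Submodule k M) :=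
  TopologicalSpace.coinduced (fun b : Fin r → M => Submodule.span k (Set.range b))
    (mZariski k (Fin r → M))

/-! ### Numerical quantities -/

/-- `codim ω_I = ∑_{a=1}^r (n - r + a - i_a)` (as an integer). -/
def codimZ (n r : ℕ) (i : Fin r → Fin n) : ℤ :=
  ∑ a : Fin r, ((n : ℤ) - (r : ℤ) + ((a : ℕ) : ℤ) - ((i a : ℕ) : ℤ))

/-- The quantity `∑_j ∑_{a ∈ K^j} (n - r + a - i^j_a) - d(n - r)` of Inequality `(†^𝓘_𝓚)`. -/
def daggerZ (n r d : ℕ) {s : ℕ} (I : Fin s → Fin r → Fin n)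
    (K : Fin s → Fin d → Fin r) : ℤ :=
  (∑ j : Fin s, ∑ t : Fin d,
      ((n : ℤ) - (r : ℤ) + ((K j t : ℕ) : ℤ) - ((I j (K j t) : ℕ) : ℤ)))
    - (d : ℤ) * ((n : ℤ) - (r : ℤ))

/-- The expected dimension `dim(S, M, 𝓕) = d(m - d) - ∑_j ∑_{t=1}^d (m - d + t - k^j_t)`
of an intersection of Schubert cells `Ω°_{K^j}` in `Gr(d, m)`. -/
def eDimZ {s : ℕ} (m d : ℕ) (K : Fin s → Fin d → Fin m) : ℤ :=
  (d : ℤ) * ((m : ℤ) - (d : ℤ)) -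
    ∑ j : Fin s, ∑ t : Fin d,
      ((m : ℤ) - (d : ℤ) + ((t : ℕ) : ℤ) - ((K j t : ℕ) : ℤ))

/-- `codim ω_I` as a natural number. -/
def codimN (n r : ℕ) (i : Fin r → Fin n) : ℕ :=
  ∑ a : Fin r, ((n - r + (a : ℕ)) - (i a : ℕ))

/-! ### The cohomology ring of the Grassmannian, Schubert classes -/

/-- The ideal `(h_{n-r+1}, …, h_n)` of the polynomial ring in `r` variables
(`h_m` the complete homogeneous symmetric polynomials). -/
def grassIdeal (r n : ℕ) : Ideal (MvPolynomial (Fin r) ℤ) :=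
  Ideal.span ((fun m : ℕ => MvPolynomial.hsymm (Fin r) ℤ m) '' Set.Icc (n - r + 1) n)

/-- A presentation of the cohomology (Chow) ring `H^*(Gr(r,n))`: products of Schubert
classes vanish here exactly when they vanish in `H^*(Gr(r,n))`. -/
abbrev grassRing (r n : ℕ) : Type :=
  MvPolynomial (Fin r) ℤ ⧸ grassIdeal r n

/-- `h_m` for an integer `m` (zero for negative `m`). -/
def hkZ (r : ℕ) (m : ℤ) : MvPolynomial (Fin r) ℤ :=
  if 0 ≤ m then MvPolynomial.hsymm (Fin r) ℤ m.toNat else 0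

/-- The Schur polynomial (Jacobi–Trudi determinant) of the partition
`λ_a = n - r + a - i_a` attached to the subset `I ⊆ [n]` recorded by `i`. -/
def schurI {n r : ℕ} (i : Fin r → Fin n) : MvPolynomial (Fin r) ℤ :=
  Matrix.det (Matrix.of fun a b : Fin r =>
    hkZ r ((n : ℤ) - (r : ℤ) + ((b : ℕ) : ℤ) - ((i a : ℕ) : ℤ)))

/-- The Schubert class `ω_I ∈ H^*(Gr(r,n))` of the subset `I ⊆ [n]` recorded by the
strictly increasing tuple `i : Fin r → Fin n`. -/
def omegaCls {n r : ℕ} (i : Fin r → Fin n) : grassRing r n :=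
  Ideal.Quotient.mk (grassIdeal r n) (schurI i)

/-- The class of a point in `H^*(Gr(r,n))`: the Schubert class of `I = {1, …, r}`. -/
def pointCls (r n : ℕ) (h : r ≤ n) : grassRing r n :=
  omegaCls (fun a : Fin r => Fin.castLE h a)

/-! ### Schur polynomials of partitions, Littlewood–Richardson coefficients -/

/-- The Schur polynomial of a partition with at most `r` parts, via Jacobi–Trudi. -/
def schurP {r : ℕ} (lam : Fin r → ℕ) : MvPolynomial (Fin r) ℤ :=
  Matrix.det (Matrix.of fun a b : Fin r =>
    hkZ r (((lam a : ℕ) : ℤ) - ((a : ℕ) : ℤ) + ((b : ℕ) : ℤ)))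

/-- The Vandermonde alternant `a_δ = det(x_a^{r-1-b})`. -/
def alternant (r : ℕ) : MvPolynomial (Fin r) ℤ :=
  Matrix.det (Matrix.of fun a b : Fin r => (MvPolynomial.X a) ^ (r - 1 - (b : ℕ)))

/-- The coefficient of the Schur polynomial `s_δ` in a symmetric polynomial `f`
(in `r` variables): the coefficient of the monomial `x^{δ + (r-1, …, 1, 0)}` in `f ⬝ a_δ`. -/
def schurCoeff (r : ℕ) (f : MvPolynomial (Fin r) ℤ) (δ : Fin r → ℕ) : ℤ :=
  MvPolynomial.coeff
    (Finsupp.equivFunOnFinite.symm (fun a : Fin r => δ a + (r - 1 - (a : ℕ))))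
    (f * alternant r)

/-- The Littlewood–Richardson coefficient `c^λ_{μ,ν}` (partitions with at most `r` parts):
the multiplicity of `V_λ` in `V_μ ⊗ V_ν`, i.e. of `s_λ` in `s_μ s_ν`. -/
def lrCoeff (r : ℕ) (lam mu nu : Fin r → ℕ) : ℤ :=
  schurCoeff r (schurP mu * schurP nu) lam

/-- The multiplicity of `V_δ` in `V_{Λ 1} ⊗ ⋯ ⊗ V_{Λ t}` (as `GL(r)`-representations),
i.e. of `s_δ` in `∏_j s_{Λ j}`. -/
def multiCoeff (r : ℕ) {t : ℕ} (Λ : Fin t → Fin r → ℕ) (δ : Fin r → ℕ) : ℤ :=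
  schurCoeff r (∏ j : Fin t, schurP (Λ j)) δ


/-- If a finite directed multigraph carries a nonzero circulation with values in some abelian
group, then it carries a nonzero real circulation. -/
theorem exists_real_circulation {E N A : Type*} [DecidableEq E] [DecidableEq N] [AddCommGroup A]
    (F : Finset E) (s t : E → N) (z : E → A)
    (hz : ∀ n, ∑ e ∈ F with s e = n, z e = ∑ e ∈ F with t e = n, z e)
    (hne : ∃ e ∈ F, z e ≠ 0) :
    ∃ y : E → ℝ, (∀ e ∉ F, y e = 0) ∧ (∃ e ∈ F, y e ≠ 0) ∧
      ∀ n, ∑ e ∈ F with s e = n, y e = ∑ e ∈ F with t e = n, y e := by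
  classical
  set S : Finset E := F.filter (fun e => z e ≠ 0) with hS
  set T : Finset N := S.image s ∪ S.image t with hT
  have hSF : S ⊆ F := Finset.filter_subset _ _
  have sumS : ∀ (q : E → N) (n : N), ∑ e ∈ S with q e = n, z e = ∑ e ∈ F with q e = n, z e := by
    intro q n
    refine Finset.sum_subset (Finset.filter_subset_filter _ hSF) ?_
    intro e he he'
    by_contra h
    exact he' (by simp_all)
  have hzS : ∀ n, ∑ e ∈ S with s e = n, z e = ∑ e ∈ S with t e = n, z e := by
    intro n; rw [sumS, sumS, hz]
  have hzne : ∀ e ∈ S, z e ≠ 0 := fun e he => (Finset.mem_filter.1 he).2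
  have hdeg : ∀ n ∈ T, 2 ≤ (S.filter (fun e => s e = n)).card
      + (S.filter (fun e => t e = n)).card := by
    intro n hn
    by_contra hlt
    have key : ∀ P Q : Finset E, P.card + Q.card < 2 → 0 < P.card → (∀ e ∈ P, z e ≠ 0) →
        ∑ e ∈ P, z e = ∑ e ∈ Q, z e → False := by
      intro P Q h1 h2 h3 h4
      have hQ : Q = ∅ := by rw [← Finset.card_eq_zero]; omega
      obtain ⟨a, ha⟩ := Finset.card_eq_one.1 (show P.card = 1 by omega)
      subst hQ
      rw [ha] at h4
      simp only [Finset.sum_singleton, Finset.sum_empty] at h4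
      exact h3 a (by simp [ha]) h4
    have hz1 : ∀ q : E → N, ∀ e ∈ S.filter (fun e => q e = n), z e ≠ 0 :=
      fun q e he => hzne e (Finset.mem_filter.1 he).1
    rcases Finset.mem_union.1 hn with h | h
    · obtain ⟨e, he, hen⟩ := Finset.mem_image.1 h
      refine key _ _ (not_le.1 hlt) (Finset.card_pos.2 ⟨e, ?_⟩) (hz1 s) (hzS n)
      simp [he, hen]
    · obtain ⟨e, he, hen⟩ := Finset.mem_image.1 h
      refine key _ _ (by rw [add_comm]; exact not_le.1 hlt)
        (Finset.card_pos.2 ⟨e, ?_⟩) (hz1 t) (hzS n).symm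
      simp [he, hen]
  have hcard : T.card ≤ S.card := by
    have h1 : S.card = ∑ n ∈ T, (S.filter (fun e => s e = n)).card :=
      Finset.card_eq_sum_card_fiberwise fun e he =>
        Finset.mem_union_left _ (Finset.mem_image_of_mem s he)
    have h2 : S.card = ∑ n ∈ T, (S.filter (fun e => t e = n)).card :=
      Finset.card_eq_sum_card_fiberwise fun e he =>
        Finset.mem_union_right _ (Finset.mem_image_of_mem t he)
    have h3 : T.card * 2 ≤ ∑ n ∈ T, ((S.filter (fun e => s e = n)).card
        + (S.filter (fun e => t e = n)).card) := by
      have := Finset.card_nsmul_le_sum T _ 2 hdeg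
      simpa using this
    rw [Finset.sum_add_distrib, ← h1, ← h2] at h3
    omega
  obtain ⟨e₀, he₀F, he₀⟩ := hne
  have he₀S : e₀ ∈ S := Finset.mem_filter.2 ⟨he₀F, he₀⟩
  let d : (S → ℝ) →ₗ[ℝ] (T → ℝ) :=
    { toFun := fun y n =>
        (∑ e : S, if s e = n then y e else 0) - ∑ e : S, if t e = n then y e else 0
      map_add' := by
        intro x y; ext n
        simp only [Pi.add_apply, ← Finset.sum_sub_distrib, ← Finset.sum_add_distrib]
        refine Finset.sum_congr rfl fun e _ => ?_
        split_ifs <;> ring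
      map_smul' := by
        intro c y; ext n
        simp only [Pi.smul_apply, smul_eq_mul, RingHom.id_apply, ← Finset.sum_sub_distrib,
          Finset.mul_sum]
        refine Finset.sum_congr rfl fun e _ => ?_
        split_ifs <;> ring }
  let σ : (T → ℝ) →ₗ[ℝ] ℝ := ∑ n : T, LinearMap.proj n
  have hσ : ∀ x, σ x = ∑ n : T, x n := fun x => by simp [σ]
  have hσd : LinearMap.range d ≤ LinearMap.ker σ := by
    rintro _ ⟨y, rfl⟩
    rw [LinearMap.mem_ker, hσ]
    simp only [d, LinearMap.coe_mk, AddHom.coe_mk, Finset.sum_sub_distrib]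
    rw [Finset.sum_comm, Finset.sum_comm (f := fun (n : T) (e : S) => if t e = n then y e else 0)]
    have aux : ∀ (q : E → N) (hq : ∀ e ∈ S, q e ∈ T) (e : S),
        (∑ n : T, if q e = n then y e else 0) = y e := by
      intro q hq e
      rw [Finset.sum_eq_single (⟨q e, hq e e.2⟩ : T)]
      · simp
      · intro b _ hb
        rw [if_neg]
        intro h; exact hb (Subtype.ext h.symm)
      · simp
    rw [Finset.sum_congr rfl fun e _ => aux s (fun e he =>
        Finset.mem_union_left _ (Finset.mem_image_of_mem s he)) e,
      Finset.sum_congr rfl fun e _ => aux t (fun e he =>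
        Finset.mem_union_right _ (Finset.mem_image_of_mem t he)) e, sub_self]
  have hlt : finrank ℝ (LinearMap.range d) < finrank ℝ (S → ℝ) := by
    calc finrank ℝ (LinearMap.range d) ≤ finrank ℝ (LinearMap.ker σ) :=
          Submodule.finrank_mono hσd
      _ < finrank ℝ (T → ℝ) := by
          apply Submodule.finrank_lt
          intro h
          have hn : s e₀ ∈ T := Finset.mem_union_left _ (Finset.mem_image_of_mem s he₀S)
          have : Pi.single (⟨s e₀, hn⟩ : T) (1 : ℝ) ∈ LinearMap.ker σ := by rw [h]; trivial
          rw [LinearMap.mem_ker, hσ] at this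
          simp at this
      _ ≤ finrank ℝ (S → ℝ) := by simpa using hcard
  have hker : ∃ y, d y = 0 ∧ y ≠ 0 := by
    by_contra hcon
    push Not at hcon
    have hinj : Function.Injective d := (injective_iff_map_eq_zero d).2 hcon
    rw [LinearMap.finrank_range_of_inj hinj] at hlt
    exact lt_irrefl _ hlt
  obtain ⟨y, hy, hy0⟩ := hker
  let w : E → ℝ := fun e => if h : e ∈ S then y ⟨e, h⟩ else 0
  have hw : ∀ e : S, w e = y e := fun e => by simp [w]
  have hw0 : ∀ e ∉ S, w e = 0 := fun e he => by simp [w, he]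
  refine ⟨w, fun e he => hw0 e (fun h => he (hSF h)), ?_, ?_⟩
  · obtain ⟨e, he⟩ := Function.ne_iff.1 hy0
    exact ⟨e, hSF e.2, by rw [hw]; exact he⟩
  · intro n
    have aux : ∀ q : E → N, ∑ e ∈ F with q e = n, w e = ∑ e : S, if q e = n then y e else 0 := by
      intro q
      rw [Finset.sum_filter, ← Finset.sum_subset hSF, ← Finset.sum_coe_sort]
      · exact Finset.sum_congr rfl fun e _ => by rw [hw]
      · intro e _ he; rw [hw0 e he, ite_self]
    rw [aux, aux]
    by_cases hn : n ∈ T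
    · have := congrFun hy ⟨n, hn⟩
      simp only [d, LinearMap.coe_mk, AddHom.coe_mk, Pi.zero_apply] at this
      linarith
    · rw [Finset.sum_eq_zero, Finset.sum_eq_zero]
      · intro e _
        rw [if_neg]
        rintro rfl; exact hn (Finset.mem_union_right _ (Finset.mem_image_of_mem t e.2))
      · intro e _
        rw [if_neg]
        rintro rfl; exact hn (Finset.mem_union_left _ (Finset.mem_image_of_mem s e.2))

/-! ### Hives -/

/-- The six unit directions of the triangular lattice, in cyclic order. -/
def hexDir : Fin 6 → ℤ × ℤ := ![(1, 0), (1, 1), (0, 1), (-1, 0), (-1, -1), (0, -1)]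

/-- The rhombus form of `h` at the rhombus whose short diagonal is the edge from `v` in
direction `i`. -/
def rhomb {A : Type*} [AddCommGroup A] (h : ℤ × ℤ → A) (v : ℤ × ℤ) (i : Fin 6) : A :=
  h v + h (v + hexDir i) - h (v + hexDir (i - 1)) - h (v + hexDir (i + 1))

/-- Lattice points of the triangle of side `r`. -/
def InTri (r : ℕ) (v : ℤ × ℤ) : Prop := 0 ≤ v.1 ∧ v.1 ≤ v.2 ∧ v.2 ≤ r

/-- Interior lattice points of the triangle of side `r`. -/
def InInt (r : ℕ) (v : ℤ × ℤ) : Prop := 0 < v.1 ∧ v.1 < v.2 ∧ v.2 < r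

/-- The rhombus around the edge from `v` in direction `i` is contained in the triangle. -/
def InnerEdge (r : ℕ) (v : ℤ × ℤ) (i : Fin 6) : Prop :=
  InTri r v ∧ InTri r (v + hexDir i) ∧ InTri r (v + hexDir (i - 1)) ∧
    InTri r (v + hexDir (i + 1))

/-- All rhombus inequalities of `h` hold. -/
def IsHive (r : ℕ) (h : ℤ × ℤ → ℝ) : Prop := ∀ v i, InnerEdge r v i → 0 ≤ rhomb h v i

/-- The rhombus inequality of `h` at an edge is an equality. -/
def Tight (r : ℕ) (h : ℤ × ℤ → ℝ) (v : ℤ × ℤ) (i : Fin 6) : Prop :=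
  InnerEdge r v i ∧ rhomb h v i = 0

/-- The lattice points of the triangle, as a finite set. -/
def triPts (r : ℕ) : Finset (ℤ × ℤ) :=
  (Finset.Icc (0 : ℤ) r ×ˢ Finset.Icc (0 : ℤ) r).filter fun v => v.1 ≤ v.2

theorem mem_triPts {r : ℕ} {v : ℤ × ℤ} : v ∈ triPts r ↔ InTri r v := by
  simp only [triPts, InTri, Finset.mem_filter, Finset.mem_product, Finset.mem_Icc]
  omega

theorem InInt.inTri {r : ℕ} {v : ℤ × ℤ} (h : InInt r v) : InTri r v := by
  unfold InInt at h; unfold InTri; omega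

theorem hexDir_add_three (i : Fin 6) : hexDir (i + 3) = -hexDir i := by
  revert i; decide

theorem InInt.inTri_add {r : ℕ} {v : ℤ × ℤ} (h : InInt r v) (i : Fin 6) :
    InTri r (v + hexDir i) := by
  unfold InInt at h
  fin_cases i <;> simp [InTri, hexDir] <;> omega

theorem InInt.innerEdge {r : ℕ} {v : ℤ × ℤ} (h : InInt r v) (i : Fin 6) : InnerEdge r v i :=
  ⟨h.inTri, h.inTri_add _, h.inTri_add _, h.inTri_add _⟩

theorem not_inInt_neighbours {r : ℕ} {v : ℤ × ℤ} {i : Fin 6} (hv : ¬ InInt r v)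
    (h1 : InTri r (v + hexDir i)) (h2 : InTri r (v + hexDir (i + 3))) :
    ¬ InInt r (v + hexDir i) ∧ ¬ InInt r (v + hexDir (i + 3)) := by
  rw [hexDir_add_three] at h2 ⊢
  fin_cases i <;> simp [InTri, InInt, hexDir] at hv h1 h2 ⊢ <;> omega

section

variable {A : Type*} [AddCommGroup A]

theorem rhomb_neg (g : ℤ × ℤ → A) (v : ℤ × ℤ) (i : Fin 6) :
    rhomb (-g) v i = -rhomb g v i := by
  simp only [rhomb, Pi.neg_apply]; abel

theorem rhomb_map {B : Type*} [AddCommGroup B] (f : A →+ B) (g : ℤ × ℤ → A) (v : ℤ × ℤ)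
    (i : Fin 6) : rhomb (fun w => f (g w)) v i = f (rhomb g v i) := by
  simp only [rhomb, map_add, map_sub]

theorem add_hexDir_opp (v : ℤ × ℤ) (i : Fin 6) :
    v + hexDir i + hexDir (i + 3) = v ∧
    v + hexDir i + hexDir (i + 3 - 1) = v + hexDir (i + 1) ∧
    v + hexDir i + hexDir (i + 3 + 1) = v + hexDir (i - 1) := by
  refine ⟨?_, ?_, ?_⟩ <;> rw [add_assoc] <;> [skip; congr 1; congr 1] <;>
    [(rw [hexDir_add_three]; abel); (revert i; decide); (revert i; decide)]

theorem rhomb_opp (h : ℤ × ℤ → A) (v : ℤ × ℤ) (i : Fin 6) :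
    rhomb h (v + hexDir i) (i + 3) = rhomb h v i := by
  obtain ⟨h1, h2, h3⟩ := add_hexDir_opp v i
  rw [rhomb, h1, h2, h3, rhomb]; abel

theorem InnerEdge.opp {r : ℕ} {v : ℤ × ℤ} {i : Fin 6} (h : InnerEdge r v i) :
    InnerEdge r (v + hexDir i) (i + 3) := by
  obtain ⟨h1, h2, h3⟩ := add_hexDir_opp v i
  obtain ⟨a, b, c, d⟩ := h
  exact ⟨b, by rwa [h1], by rwa [h2], by rwa [h3]⟩

theorem Tight.opp {r : ℕ} {h : ℤ × ℤ → ℝ} {v : ℤ × ℤ} {i : Fin 6} (ht : Tight r h v i) :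
    Tight r h (v + hexDir i) (i + 3) :=
  ⟨ht.1.opp, by rw [rhomb_opp]; exact ht.2⟩

theorem rhomb_add_succ (h : ℤ × ℤ → A) (v : ℤ × ℤ) (i : Fin 6) :
    rhomb h v i + rhomb h v (i + 1) =
      2 • h v - h (v + hexDir (i + 2)) - h (v + hexDir (i + 2 + 3)) := by
  have e1 : i + 2 + 3 = i - 1 := by revert i; decide
  have e2 : i + 1 + 1 = i + 2 := by revert i; decide
  simp only [rhomb, e1, e2, add_sub_cancel_right]; abel

end

theorem finite_innerEdge (r : ℕ) : {p : (ℤ × ℤ) × Fin 6 | InnerEdge r p.1 p.2}.Finite := by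
  refine ((triPts r ×ˢ (Finset.univ : Finset (Fin 6))).finite_toSet).subset ?_
  rintro ⟨v, i⟩ h
  simpa [mem_triPts] using h.1

/-- A perturbation which is feasible at the tight rhombi is feasible when scaled down. -/
theorem IsHive.exists_perturb {r : ℕ} {h g : ℤ × ℤ → ℝ} (hh : IsHive r h)
    (hg : ∀ v i, Tight r h v i → 0 ≤ rhomb g v i) :
    ∀ᶠ ε : ℝ in nhdsWithin 0 (Set.Ioi 0), IsHive r (h + ε • g) := by
  have key : ∀ p ∈ {p : (ℤ × ℤ) × Fin 6 | InnerEdge r p.1 p.2},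
      ∀ᶠ ε : ℝ in nhdsWithin 0 (Set.Ioi 0), 0 ≤ rhomb (h + ε • g) p.1 p.2 := by
    rintro ⟨v, i⟩ hp
    have e : ∀ ε : ℝ, rhomb (h + ε • g) v i = rhomb h v i + ε * rhomb g v i := by
      intro ε; simp only [rhomb, Pi.add_apply, Pi.smul_apply, smul_eq_mul]; ring
    simp only [e]
    rcases (hh v i hp).eq_or_lt with h0 | h0
    · filter_upwards [self_mem_nhdsWithin] with ε hε
      rw [← h0, zero_add]
      exact mul_nonneg (le_of_lt hε) (hg v i ⟨hp, h0.symm⟩)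
    · have : Filter.Tendsto (fun ε : ℝ => rhomb h v i + ε * rhomb g v i) (nhdsWithin 0 (Set.Ioi 0))
          (nhds (rhomb h v i + 0 * rhomb g v i)) :=
        ((by fun_prop : Continuous fun ε : ℝ => rhomb h v i + ε * rhomb g v i).tendsto 0).mono_left
          nhdsWithin_le_nhds
      rw [zero_mul, add_zero] at this
      filter_upwards [this.eventually (lt_mem_nhds h0)] with ε hε using hε.le
  have := (Filter.eventually_all_finite (finite_innerEdge r)).2 key
  filter_upwards [this] with ε hε v i hvi using hε (v, i) hvi

/-- The hives with prescribed values outside the interior of the triangle. -/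
def hiveSet (r : ℕ) (b : ℤ × ℤ → ℝ) : Set (ℤ × ℤ → ℝ) :=
  {h | IsHive r h ∧ ∀ v, ¬ InInt r v → h v = b v}

theorem continuous_rhomb (v : ℤ × ℤ) (i : Fin 6) :
    Continuous fun h : ℤ × ℤ → ℝ => rhomb h v i := by
  unfold rhomb; fun_prop

theorem isClosed_isHive (r : ℕ) : IsClosed {h | IsHive r h} := by
  simp only [IsHive, Set.ofPred_forall]
  exact isClosed_iInter fun v => isClosed_iInter fun i => isClosed_iInter fun _ =>
    isClosed_le continuous_const (continuous_rhomb v i)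

theorem isClosed_hiveSet (r : ℕ) (b : ℤ × ℤ → ℝ) : IsClosed (hiveSet r b) := by
  have : hiveSet r b = {h | IsHive r h} ∩ ⋂ v, ⋂ _ : ¬ InInt r v, {h | h v = b v} := by
    ext h; simp [hiveSet]
  rw [this]
  refine (isClosed_isHive r).inter ?_
  exact isClosed_iInter fun v => isClosed_iInter fun _ =>
    isClosed_eq (continuous_apply v) continuous_const

/-- Consecutive differences of a hive are bounded by its boundary differences. -/
theorem IsHive.abs_sub_le {r : ℕ} {h : ℤ × ℤ → ℝ} (hh : IsHive r h) {C : ℝ}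
    (hC : ∀ j : ℤ, 0 ≤ j → j < r → |h (0, j + 1) - h (0, j)| ≤ C) (k : ℕ) (j : ℤ)
    (hkj : (k : ℤ) ≤ j) (hj : j < r) : |h (k, j + 1) - h (k, j)| ≤ C := by
  induction k generalizing j with
  | zero => simpa using hC j (by simpa using hkj) hj
  | succ k ih =>
    push_cast at hkj ⊢
    have h1 := hh (k, j) 1 (by simp [InnerEdge, InTri, hexDir]; omega)
    have h2 := hh (k, j) 0 (by simp [InnerEdge, InTri, hexDir]; omega)
    have i1 := abs_le.1 (ih j (by omega) hj)
    have i2 := abs_le.1 (ih (j - 1) (by omega) (by omega))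
    simp [rhomb, hexDir, ← sub_eq_add_neg] at h1 h2 i2
    exact abs_le.2 ⟨by linarith, by linarith⟩

theorem IsHive.abs_le {r : ℕ} {h : ℤ × ℤ → ℝ} (hh : IsHive r h) {C M : ℝ}
    (hC : ∀ j : ℤ, 0 ≤ j → j < r → |h (0, j + 1) - h (0, j)| ≤ C)
    (hM : ∀ k : ℤ, 0 ≤ k → k ≤ r → |h (k, k)| ≤ M) (k m : ℕ) (hm : (k : ℤ) + m ≤ r) :
    |h (k, k + m)| ≤ M + m * C := by
  induction m with
  | zero => simpa using hM k (by omega) (by simpa using hm)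
  | succ m ih =>
    push_cast at hm ⊢
    have := hh.abs_sub_le hC k (k + m) (by omega) (by omega)
    have h2 := ih (by omega)
    rw [← add_assoc]
    calc |h (k, (k : ℤ) + m + 1)| =
          |h (k, (k : ℤ) + m) + (h (k, (k : ℤ) + m + 1) - h (k, (k : ℤ) + m))| := by
          congr 1; ring
      _ ≤ _ := abs_add_le _ _
      _ ≤ M + (m + 1) * C := by linarith

theorem exists_hive_bound (r : ℕ) (B : ℝ) : ∃ M : ℝ, ∀ h, IsHive r h →
    (∀ v, InTri r v → ¬ InInt r v → |h v| ≤ B) → ∀ v, InTri r v → |h v| ≤ M := by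
  refine ⟨B + r * (B + B), fun h hh hB v hv => ?_⟩
  have hB0 : 0 ≤ B := (abs_nonneg _).trans (hB (0, 0) (by simp [InTri]) (by simp [InInt]))
  obtain ⟨k, i⟩ := v
  obtain ⟨h1, h2, h3⟩ := hv
  lift k to ℕ using h1
  obtain ⟨m, rfl⟩ : ∃ m : ℕ, i = k + m := ⟨(i - k).toNat, by simp at h2; omega⟩
  simp only at h3
  have := hh.abs_le (C := B + B) (M := B) (fun j hj hj' => ?_) (fun j hj hj' => ?_) k m h3
  · refine this.trans ?_
    have : (m : ℝ) ≤ r := by exact_mod_cast (by omega : m ≤ r)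
    nlinarith
  · refine (abs_sub _ _).trans (add_le_add (hB _ ?_ ?_) (hB _ ?_ ?_)) <;>
      simp [InTri, InInt] <;> omega
  · exact hB _ (by simp [InTri]; omega) (by simp [InInt])

theorem isCompact_hiveSet (r : ℕ) (b : ℤ × ℤ → ℝ) : IsCompact (hiveSet r b) := by
  obtain ⟨M, hM⟩ := exists_hive_bound r (∑ v ∈ triPts r, |b v|)
  refine IsCompact.of_isClosed_subset
    (isCompact_univ_pi fun v : ℤ × ℤ => isCompact_Icc (a := -(max M |b v|)) (b := max M |b v|))
    (isClosed_hiveSet r b) ?_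
  intro h hh v _
  refine abs_le.1 (?_ : |h v| ≤ max M |b v|)
  by_cases hv : InInt r v
  · refine (hM h hh.1 (fun w hw hw' => ?_) v hv.inTri).trans (le_max_left _ _)
    rw [hh.2 w hw']
    exact Finset.single_le_sum (f := fun v => |b v|) (fun _ _ => abs_nonneg _) (mem_triPts.2 hw)
  · rw [hh.2 v hv]; exact le_max_right _ _

/-- A hive is extremal and maximal for its boundary values. -/
structure IsMaxVertex (r : ℕ) (h : ℤ × ℤ → ℝ) : Prop where
  hive : IsHive r h
  sum_nonpos : ∀ g : ℤ × ℤ → ℝ, (∀ v, ¬ InInt r v → g v = 0) →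
    (∀ v i, Tight r h v i → 0 ≤ rhomb g v i) → ∑ v ∈ triPts r, g v ≤ 0
  eq_zero : ∀ g : ℤ × ℤ → ℝ, (∀ v, ¬ InInt r v → g v = 0) →
    (∀ v i, Tight r h v i → rhomb g v i = 0) → g = 0

theorem exists_isMaxVertex {r : ℕ} {b : ℤ × ℤ → ℝ} (hb : IsHive r b) :
    ∃ h ∈ hiveSet r b, IsMaxVertex r h := by
  set L : (ℤ × ℤ → ℝ) → ℝ := fun h => ∑ v ∈ triPts r, h v with hL
  have hLc : Continuous L := by fun_prop
  obtain ⟨m, hmK, hm⟩ := (isCompact_hiveSet r b).exists_isMaxOn ⟨b, hb, fun _ _ => rfl⟩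
    hLc.continuousOn
  have hcomp : IsCompact (hiveSet r b ∩ {h | L m ≤ L h}) :=
    (isCompact_hiveSet r b).inter_right (isClosed_le continuous_const hLc)
  obtain ⟨h, hext⟩ := hcomp.extremePoints_nonempty ⟨m, hmK, le_refl (L m)⟩
  rw [mem_extremePoints] at hext
  obtain ⟨⟨hK, hmax⟩, hext⟩ := hext
  have step : ∀ g : ℤ × ℤ → ℝ, (∀ v, ¬ InInt r v → g v = 0) →
      (∀ v i, Tight r h v i → 0 ≤ rhomb g v i) →
      ∀ᶠ ε : ℝ in nhdsWithin 0 (Set.Ioi 0), h + ε • g ∈ hiveSet r b := by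
    intro g hg0 hg
    filter_upwards [hK.1.exists_perturb hg] with ε hε
    exact ⟨hε, fun v hv => by simp [hg0 v hv, hK.2 v hv]⟩
  have Ladd : ∀ (ε : ℝ) g, L (h + ε • g) = L h + ε * L g := by
    intro ε g
    simp [hL, Finset.sum_add_distrib, Finset.mul_sum]
  have sumle : ∀ g : ℤ × ℤ → ℝ, (∀ v, ¬ InInt r v → g v = 0) →
      (∀ v i, Tight r h v i → 0 ≤ rhomb g v i) → L g ≤ 0 := by
    intro g hg0 hg
    obtain ⟨ε, hε, hpos⟩ := ((step g hg0 hg).and self_mem_nhdsWithin).exists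
    have h1 : L (h + ε • g) ≤ L m := hm hε
    have h2 : L m ≤ L h := hmax
    rw [Ladd] at h1
    have hpos' : 0 < ε := hpos
    by_contra hc
    push Not at hc
    nlinarith [mul_pos hpos' hc]
  refine ⟨h, hK, hK.1, sumle, fun g hg0 hg => ?_⟩
  have hn0 : ∀ v, ¬ InInt r v → (-g) v = 0 := fun v hv => by simp [hg0 v hv]
  have hp := fun v i ht => (hg v i ht).ge
  have hn : ∀ v i, Tight r h v i → 0 ≤ rhomb (-g) v i := fun v i ht => by
    rw [rhomb_neg, hg v i ht, neg_zero]
  have s1 := sumle g hg0 hp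
  have s2 := sumle (-g) hn0 hn
  have s3 : L (-g) = -L g := by simp [hL]
  have s0 : L g = 0 := by linarith
  obtain ⟨ε, ⟨e1, e2⟩, hpos⟩ :=
    (((step g hg0 hp).and (step (-g) hn0 hn)).and self_mem_nhdsWithin).exists
  have hpos' : 0 < ε := hpos
  have hm2 : L m ≤ L h := hmax
  have := (hext _ ⟨e1, show L m ≤ _ by rw [Ladd, s0]; linarith⟩ _
    ⟨e2, show L m ≤ _ by rw [Ladd, s3, s0]; linarith⟩
    ⟨1 / 2, 1 / 2, by norm_num, by norm_num, by norm_num, by ext v; simp; ring⟩)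
  funext v
  have hv := congrFun (this.1) v
  simpa [hpos'.ne'] using hv

/-- The boundary values of `b` are strictly concave along each side of the triangle. -/
def StrictBdry (r : ℕ) (b : ℤ × ℤ → ℝ) : Prop :=
  ∀ v i, ¬ InInt r v → InTri r v → InTri r (v + hexDir i) → InTri r (v + hexDir (i + 3)) →
    b (v + hexDir i) + b (v + hexDir (i + 3)) < 2 * b v

theorem StrictBdry.congr {r : ℕ} {b h : ℤ × ℤ → ℝ} (hb : StrictBdry r b)
    (hbh : ∀ v, ¬ InInt r v → h v = b v) : StrictBdry r h := by
  intro v i hv hv1 h1 h2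
  obtain ⟨h3, h4⟩ := not_inInt_neighbours hv h1 h2
  rw [hbh _ hv, hbh _ h3, hbh _ h4]
  exact hb v i hv hv1 h1 h2

theorem innerEdge_half {r : ℕ} {v : ℤ × ℤ} {i : Fin 6} (h : InTri r v)
    (h1 : InTri r (v + hexDir i)) (h2 : InTri r (v + hexDir (i + 3))) :
    (InnerEdge r v (i + 1) ∧ InnerEdge r v (i + 1 + 1)) ∨
      (InnerEdge r v (i + 4) ∧ InnerEdge r v (i + 4 + 1)) := by
  fin_cases i <;> simp [InnerEdge, InTri, hexDir] at h h1 h2 ⊢ <;> omega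

theorem IsHive.bdry_concave {r : ℕ} {b : ℤ × ℤ → ℝ} (hb : IsHive r b) {v : ℤ × ℤ} {i : Fin 6}
    (h : InTri r v)
    (h1 : InTri r (v + hexDir i)) (h2 : InTri r (v + hexDir (i + 3))) :
    b (v + hexDir i) + b (v + hexDir (i + 3)) ≤ 2 * b v := by
  have e1 : i + 1 + 2 = i + 3 := (by decide : ∀ i : Fin 6, i + 1 + 2 = i + 3) i
  have e2 : i + 3 + 3 = i := (by decide : ∀ i : Fin 6, i + 3 + 3 = i) i
  have e3 : i + 4 + 2 = i := (by decide : ∀ i : Fin 6, i + 4 + 2 = i) i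
  rcases innerEdge_half h h1 h2 with ⟨ha, hc⟩ | ⟨ha, hc⟩
  · have := rhomb_add_succ b v (i + 1)
    rw [e1, e2, two_nsmul] at this
    have := hb _ _ ha
    have := hb _ _ hc
    linarith
  · have := rhomb_add_succ b v (i + 4)
    rw [e3, two_nsmul] at this
    have := hb _ _ ha
    have := hb _ _ hc
    linarith

/-- A strictly concave quadratic function on the triangular lattice. -/
def quadHive (v : ℤ × ℤ) : ℝ := -((v.1 : ℝ) ^ 2 - v.1 * v.2 + v.2 ^ 2)

theorem rhomb_quadHive (v : ℤ × ℤ) (i : Fin 6) : rhomb quadHive v i = 1 := by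
  fin_cases i <;> simp [rhomb, quadHive, hexDir] <;> ring

theorem isHive_add_quadHive {r : ℕ} {b : ℤ × ℤ → ℝ} (hb : IsHive r b) {ε : ℝ} (hε : 0 < ε) :
    IsHive r (b + ε • quadHive) ∧ StrictBdry r (b + ε • quadHive) := by
  refine ⟨fun v i h => ?_, fun v i _ h h1 h2 => ?_⟩
  · have e : rhomb (b + ε • quadHive) v i = rhomb b v i + ε * rhomb quadHive v i := by
      simp only [rhomb, Pi.add_apply, Pi.smul_apply, smul_eq_mul]; ring
    rw [e, rhomb_quadHive]
    have := hb v i h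
    linarith
  · have := hb.bdry_concave h h1 h2
    have q : quadHive (v + hexDir i) + quadHive (v + hexDir (i + 3)) < 2 * quadHive v := by
      rw [hexDir_add_three]
      fin_cases i <;> simp [quadHive, hexDir] <;> nlinarith
    simp only [Pi.add_apply, Pi.smul_apply, smul_eq_mul]
    nlinarith

theorem Tight.consecutive {r : ℕ} {h : ℤ × ℤ → ℝ} (hh : IsHive r h) (hs : StrictBdry r h)
    {v : ℤ × ℤ} {i : Fin 6} (h1 : Tight r h v i) (h2 : Tight r h v (i + 1)) :
    InInt r v ∧ Tight r h v (i + 3) ∧ Tight r h v (i + 4) := by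
  have e1 : i + 1 + 1 = i + 2 := (by decide : ∀ i : Fin 6, i + 1 + 1 = i + 2) i
  have e2 : i - 1 = i + 2 + 3 := (by decide : ∀ i : Fin 6, i - 1 = i + 2 + 3) i
  have e3 : i + 3 + 2 + 3 = i + 2 := (by decide : ∀ i : Fin 6, i + 3 + 2 + 3 = i + 2) i
  have e4 : i + 3 + 2 = i + 2 + 3 := (by decide : ∀ i : Fin 6, i + 3 + 2 = i + 2 + 3) i
  have e5 : i + 3 + 1 = i + 4 := (by decide : ∀ i : Fin 6, i + 3 + 1 = i + 4) i
  have s1 := rhomb_add_succ h v i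
  have s2 := rhomb_add_succ h v (i + 3)
  rw [h1.2, h2.2, two_nsmul] at s1
  rw [e3, e4, e5, two_nsmul] at s2
  have hint : InInt r v := by
    by_contra hv
    have := hs v (i + 2) hv h1.1.1 (e1 ▸ h2.1.2.2.2) (e2 ▸ h1.1.2.2.1)
    linarith
  have p1 := hh _ _ (hint.innerEdge (i + 3))
  have p2 := hh _ _ (hint.innerEdge (i + 4))
  exact ⟨hint, ⟨hint.innerEdge _, by linarith⟩, ⟨hint.innerEdge _, by linarith⟩⟩

open Classical in
/-- For the set `P` of tight directions at a vertex: the dimension of the linear span of the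
cell of the concave function dual to that vertex (`0` if no two consecutive directions are
tight, `1` if the non-tight directions are an opposite pair, `2` if all are tight). -/
def cellDim (P : Fin 6 → Prop) : ℝ :=
  if ∀ i, P i then 2 else if ∃ i, P i ∧ P (i + 1) then 1 else 0

theorem fin_six_cases (j k : Fin 6) :
    j = k ∨ j = k + 1 ∨ j = k + 2 ∨ j = k + 3 ∨ j = k + 4 ∨ j = k + 5 := by
  revert j k; decide

theorem cellDim_concave {A B C D : Fin 6 → Prop}
    (hA : ∀ i, A i → A (i + 1) → A (i + 3) ∧ A (i + 4))
    (hB : ∀ i, B i → B (i + 1) → B (i + 3) ∧ B (i + 4))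
    (hC : ∀ i, C i → C (i + 1) → C (i + 3) ∧ C (i + 4))
    (hD : ∀ i, D i → D (i + 1) → D (i + 3) ∧ D (i + 4)) {i : Fin 6}
    (hAi : A i) (hCi : C (i + 3)) (hAB : A (i + 5) ↔ B (i + 2)) (hAD : A (i + 1) ↔ D (i + 4))
    (hCB : C (i + 4) ↔ B (i + 1)) (hCD : C (i + 2) ↔ D (i + 5)) :
    cellDim B + cellDim D ≤ cellDim A + cellDim C := by
  have val : ∀ P : Fin 6 → Prop, cellDim P = 0 ∨ cellDim P = 1 ∨ cellDim P = 2 := by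
    intro P; unfold cellDim; split_ifs <;> simp
  have two : ∀ P : Fin 6 → Prop, cellDim P = 2 → ∀ j, P j := by
    intro P; unfold cellDim; split_ifs with h h' <;> simp_all
  have one : ∀ P : Fin 6 → Prop, (∀ i, P i → P (i + 1) → P (i + 3) ∧ P (i + 4)) →
      cellDim P ≠ 0 → ∀ j, P j ∨ P (j + 1) := by
    intro P hP h0 j
    have : ∃ i, P i ∧ P (i + 1) := by
      unfold cellDim at h0
      split_ifs at h0 with h h'
      · exact ⟨0, h _, h _⟩
      · exact h'
      · simp at h0
    obtain ⟨k, h1, h2⟩ := this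
    obtain ⟨h3, h4⟩ := hP k h1 h2
    have := fin_six_cases j k
    have e : k + 2 + 1 = k + 3 ∧ k + 3 + 1 = k + 4 ∧ k + 5 + 1 = k := by
      clear this h1 h2 h3 h4; revert k; decide
    rcases this with rfl | rfl | rfl | rfl | rfl | rfl <;> simp_all
  have ge1 : ∀ P : Fin 6 → Prop, ∀ j, P j → P (j + 1) → 1 ≤ cellDim P := by
    intro P j h1 h2
    unfold cellDim
    split_ifs with h h'
    · norm_num
    · norm_num
    · exact absurd ⟨j, h1, h2⟩ h'
  have ge2 : ∀ P : Fin 6 → Prop, (∀ i, P i → P (i + 1) → P (i + 3) ∧ P (i + 4)) → ∀ j, P j →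
      P (j + 1) → P (j + 2) → cellDim P = 2 := by
    intro P hP j h1 h2 h3
    have e := (by decide : ∀ j : Fin 6, j + 1 + 1 = j + 2 ∧ j + 1 + 4 = j + 5) j
    obtain ⟨h4, h5⟩ := hP j h1 h2
    obtain ⟨-, h6⟩ := hP (j + 1) h2 (by rwa [e.1])
    rw [e.2] at h6
    have : ∀ k, P k := by
      intro k
      have := fin_six_cases k j
      rcases this with rfl | rfl | rfl | rfl | rfl | rfl <;> assumption
    simp [cellDim, this]
  have e := (by decide : ∀ i : Fin 6, i + 5 + 1 = i ∧ i + 5 + 2 = i + 1 ∧ i + 3 + 1 = i + 4 ∧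
      i + 2 + 1 = i + 3 ∧ i + 2 + 2 = i + 4 ∧ i + 1 + 1 = i + 2 ∧ i + 4 + 1 = i + 5) i
  obtain ⟨e1, e2, e3, e4, e5, e6, e7⟩ := e
  have a1 : A (i + 5) → 1 ≤ cellDim A := fun h => ge1 A (i + 5) h (by rwa [e1])
  have a2 : A (i + 1) → 1 ≤ cellDim A := fun h => ge1 A i hAi h
  have a3 : A (i + 5) → A (i + 1) → cellDim A = 2 := fun h h' =>
    ge2 A hA (i + 5) h (by rwa [e1]) (by rwa [e2])
  have c1 : C (i + 4) → 1 ≤ cellDim C := fun h => ge1 C (i + 3) hCi (by rwa [e3])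
  have c2 : C (i + 2) → 1 ≤ cellDim C := fun h => ge1 C (i + 2) h (by rwa [e4])
  have c3 : C (i + 4) → C (i + 2) → cellDim C = 2 := fun h h' =>
    ge2 C hC (i + 2) h' (by rwa [e4]) (by rwa [e5])
  have b1 := fun h => e6 ▸ one B hB h (i + 1)
  have d1 := fun h => e7 ▸ one D hD h (i + 4)
  have b2 := two B
  have d2 := two D
  have vA := val A
  have vC := val C
  have b3 : cellDim B = 2 → A (i + 5) ∧ C (i + 4) := fun h => ⟨hAB.2 (b2 h _), hCB.2 (b2 h _)⟩
  have d3 : cellDim D = 2 → A (i + 1) ∧ C (i + 2) := fun h => ⟨hAD.2 (d2 h _), hCD.2 (d2 h _)⟩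
  have b4 : cellDim B ≠ 0 → A (i + 5) ∨ C (i + 4) := fun h => by
    rw [hAB, hCB]; exact (b1 h).symm
  have d4 : cellDim D ≠ 0 → A (i + 1) ∨ C (i + 2) := fun h => by
    rw [hAD, hCD]; exact (d1 h)
  have vA0 : 0 ≤ cellDim A := by rcases vA with h | h | h <;> rw [h] <;> norm_num
  have vC0 : 0 ≤ cellDim C := by rcases vC with h | h | h <;> rw [h] <;> norm_num
  have vB := val B
  have vD := val D
  clear hA hB hC hD one two val ge1 ge2 b1 d1 b2 d2 hAB hAD hCB hCD vA vC
  rcases vB with hb | hb | hb <;> rcases vD with hd | hd | hd <;> rw [hb, hd] <;>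
    simp only [hb, hd] at b3 b4 d3 d4 <;>
    norm_num at b3 b4 d3 d4 ⊢ <;> grind

/-- At a maximal vertex no two consecutive edges at a lattice point are tight. -/
theorem IsMaxVertex.not_consecutive {r : ℕ} {h : ℤ × ℤ → ℝ} (hm : IsMaxVertex r h)
    (hs : StrictBdry r h) (v : ℤ × ℤ) (i : Fin 6) :
    ¬ (Tight r h v i ∧ Tight r h v (i + 1)) := by
  have hcons := fun v i => Tight.consecutive hm.hive hs (v := v) (i := i)
  have hiff : ∀ v i w j, w = v + hexDir i → j = i + 3 → (Tight r h v i ↔ Tight r h w j) := by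
    rintro v i _ _ rfl rfl
    refine ⟨Tight.opp, fun ht => ?_⟩
    have := ht.opp
    rwa [(add_hexDir_opp v i).1, (by decide : ∀ i : Fin 6, i + 3 + 3 = i) i] at this
  set g : ℤ × ℤ → ℝ := fun v => cellDim (Tight r h v) with hg
  have hg0 : ∀ v, 0 ≤ g v := fun v => by
    simp only [hg, cellDim]; split_ifs <;> norm_num
  have hgint : ∀ v, ¬ InInt r v → g v = 0 := by
    intro v hv
    simp only [hg, cellDim]
    split_ifs with h1 h2
    · exact absurd (hcons v 0 (h1 _) (h1 _)).1 hv
    · obtain ⟨i, h1, h2⟩ := h2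
      exact absurd (hcons v i h1 h2).1 hv
    · rfl
  have hle := hm.sum_nonpos g hgint fun v i ht => by
    have e := (by decide : ∀ i : Fin 6, i - 1 = i + 5 ∧ i + 2 = i + 5 + 3 ∧ i + 4 = i + 1 + 3 ∧
      i + 1 = i + 4 + 3 ∧ i + 5 = i + 2 + 3 ∧
      hexDir (i + 5) = hexDir i + hexDir (i + 4) ∧ hexDir (i + 1) = hexDir i + hexDir (i + 2)) i
    obtain ⟨e1, e2, e3, e4, e5, e6, e7⟩ := e
    have hc : ∀ v i, Tight r h v i → Tight r h v (i + 1) →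
      Tight r h v (i + 3) ∧ Tight r h v (i + 4) := fun v i h1 h2 => (hcons v i h1 h2).2
    have := cellDim_concave (hc v) (hc (v + hexDir (i - 1))) (hc (v + hexDir i))
      (hc (v + hexDir (i + 1))) ht ht.opp (hiff _ _ _ _ (by rw [e1]) e2)
      (hiff _ _ _ _ rfl e3) (hiff _ _ _ _ (by rw [e1, e6, add_assoc]) e4)
      (hiff _ _ _ _ (by rw [e7, add_assoc]) e5)
    simp only [rhomb, hg]
    linarith
  rintro ⟨h1, h2⟩
  have hv := (hcons v i h1 h2).1
  have := Finset.single_le_sum (f := g) (fun v _ => hg0 v) (mem_triPts.2 hv.inTri)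
  have : 0 < g v := by
    simp only [hg, cellDim]
    split_ifs with h3 h4
    · norm_num
    · norm_num
    · exact absurd ⟨i, h1, h2⟩ h4
  linarith

/-! ### Edges and triangles of the triangular lattice -/

/-- The upward triangle `w, w + (1, 0), w + (1, 1)` containing an edge. An edge is recorded by
its initial point and its direction, `(1, 0)`, `(1, 1)` or `(0, 1)`. -/
def upTri (e : (ℤ × ℤ) × Fin 3) : ℤ × ℤ := if e.2 = 2 then e.1 - (1, 0) else e.1

/-- The downward triangle `w, w + (1, 1), w + (0, 1)` containing an edge. -/
def dnTri (e : (ℤ × ℤ) × Fin 3) : ℤ × ℤ := if e.2 = 0 then e.1 - (0, 1) else e.1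

/-- The edge of an upward triangle with a given direction. -/
def upEdge (w : ℤ × ℤ) (j : Fin 3) : (ℤ × ℤ) × Fin 3 := (if j = 2 then w + (1, 0) else w, j)

/-- The edge of a downward triangle with a given direction. -/
def dnEdge (w : ℤ × ℤ) (j : Fin 3) : (ℤ × ℤ) × Fin 3 := (if j = 0 then w + (0, 1) else w, j)

theorem upTri_upEdge (w : ℤ × ℤ) (j : Fin 3) : upTri (upEdge w j) = w := by
  unfold upTri upEdge; split_ifs <;> simp_all

theorem dnTri_dnEdge (w : ℤ × ℤ) (j : Fin 3) : dnTri (dnEdge w j) = w := by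
  unfold dnTri dnEdge; split_ifs <;> simp_all

theorem upEdge_upTri (e : (ℤ × ℤ) × Fin 3) : upEdge (upTri e) e.2 = e := by
  unfold upTri upEdge; split_ifs <;> simp

theorem dnEdge_dnTri (e : (ℤ × ℤ) × Fin 3) : dnEdge (dnTri e) e.2 = e := by
  unfold dnTri dnEdge; split_ifs <;> simp

section

variable (T : (ℤ × ℤ) × Fin 3 → Prop)

open Classical in
/-- The node attached to an edge by its triangle, after gluing along the edges in `T`. -/
def gluedNode (tri : (ℤ × ℤ) × Fin 3 → ℤ × ℤ) (edge : ℤ × ℤ → Fin 3 → (ℤ × ℤ) × Fin 3)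
    (e : (ℤ × ℤ) × Fin 3) : (((ℤ × ℤ) × Fin 3) × Fin 3) ⊕ (ℤ × ℤ) :=
  if h : ∃ j, T (edge (tri e) j) then Sum.inl (edge (tri e) h.choose, e.2)
  else Sum.inr (tri e)

variable {T} {tri : (ℤ × ℤ) × Fin 3 → ℤ × ℤ} {edge : ℤ × ℤ → Fin 3 → (ℤ × ℤ) × Fin 3}

theorem gluedNode_eq_inl (h1 : ∀ w j, tri (edge w j) = w) (h2 : ∀ e, edge (tri e) e.2 = e)
    (h3 : ∀ w j, (edge w j).2 = j)
    (hT : ∀ w j j', T (edge w j) → T (edge w j') → j = j') (e e₀ : (ℤ × ℤ) × Fin 3)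
    (j : Fin 3) : gluedNode T tri edge e = Sum.inl (e₀, j) ↔ T e₀ ∧ e = edge (tri e₀) j := by
  unfold gluedNode
  constructor
  · split_ifs with h
    · intro he
      simp only [Sum.inl.injEq, Prod.mk.injEq] at he
      obtain ⟨rfl, rfl⟩ := he
      exact ⟨h.choose_spec, by rw [h1, h2]⟩
    · simp
  · rintro ⟨h4, rfl⟩
    have h : ∃ j', T (edge (tri (edge (tri e₀) j)) j') := ⟨e₀.2, by rwa [h1, h2]⟩
    have h5 := hT _ _ _ h.choose_spec (by rwa [h1, h2] : T (edge (tri (edge (tri e₀) j)) e₀.2))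
    rw [dif_pos h, h5, h1, h2, h3]

theorem gluedNode_eq_inr (h1 : ∀ w j, tri (edge w j) = w) (h2 : ∀ e, edge (tri e) e.2 = e)
    (e : (ℤ × ℤ) × Fin 3) (w : ℤ × ℤ) :
    gluedNode T tri edge e = Sum.inr w ↔ (¬ ∃ j, T (edge w j)) ∧ ∃ j, e = edge w j := by
  unfold gluedNode
  constructor
  · split_ifs with h
    · simp
    · intro he
      simp only [Sum.inr.injEq] at he
      subst he
      exact ⟨h, e.2, (h2 e).symm⟩
  · rintro ⟨h4, j, rfl⟩
    rw [h1, dif_neg h4]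

end

/-- The relations satisfied by the edge differences of a function whose rhombus forms vanish
on the edges in `T`, set to zero on `T`. -/
structure IsEdgeFlow {A : Type*} [AddCommGroup A] (T : (ℤ × ℤ) × Fin 3 → Prop)
    (z : (ℤ × ℤ) × Fin 3 → A) : Prop where
  up : ∀ w, (¬ ∃ j, T (upEdge w j)) → ∑ j, z (upEdge w j) = 0
  dn : ∀ w, (¬ ∃ j, T (dnEdge w j)) → ∑ j, z (dnEdge w j) = 0
  opp : ∀ e, T e → ∀ j, z (upEdge (upTri e) j) = z (dnEdge (dnTri e) j)

/-- The upper end of an edge in the glued graph. -/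
def upNode (T : (ℤ × ℤ) × Fin 3 → Prop) (e : (ℤ × ℤ) × Fin 3) :
    (((ℤ × ℤ) × Fin 3) × Fin 3) ⊕ ((ℤ × ℤ) ⊕ (ℤ × ℤ)) :=
  (gluedNode T upTri upEdge e).map id Sum.inl

/-- The lower end of an edge in the glued graph. -/
def dnNode (T : (ℤ × ℤ) × Fin 3 → Prop) (e : (ℤ × ℤ) × Fin 3) :
    (((ℤ × ℤ) × Fin 3) × Fin 3) ⊕ ((ℤ × ℤ) ⊕ (ℤ × ℤ)) :=
  (gluedNode T dnTri dnEdge e).map id Sum.inr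

theorem upNode_eq_inl {T : (ℤ × ℤ) × Fin 3 → Prop} {e p} :
    upNode T e = Sum.inl p ↔ gluedNode T upTri upEdge e = Sum.inl p := by
  unfold upNode; cases gluedNode T upTri upEdge e <;> simp

theorem dnNode_eq_inl {T : (ℤ × ℤ) × Fin 3 → Prop} {e p} :
    dnNode T e = Sum.inl p ↔ gluedNode T dnTri dnEdge e = Sum.inl p := by
  unfold dnNode; cases gluedNode T dnTri dnEdge e <;> simp

theorem upNode_eq_inr {T : (ℤ × ℤ) × Fin 3 → Prop} {e p} :
    upNode T e = Sum.inr (Sum.inl p) ↔ gluedNode T upTri upEdge e = Sum.inr p := by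
  unfold upNode; cases gluedNode T upTri upEdge e <;> simp

theorem dnNode_eq_inr {T : (ℤ × ℤ) × Fin 3 → Prop} {e p} :
    dnNode T e = Sum.inr (Sum.inr p) ↔ gluedNode T dnTri dnEdge e = Sum.inr p := by
  unfold dnNode; cases gluedNode T dnTri dnEdge e <;> simp

theorem sum_filter_eq_of_support {E N A : Type*} [DecidableEq E] [DecidableEq N]
    [AddCommGroup A] {F : Finset E} {z : E → A} (hz : ∀ e ∉ F, z e = 0) (s : E → N) (n : N)
    (S : Finset E) (hS : ∀ e, s e = n ↔ e ∈ S) : ∑ e ∈ F with s e = n, z e = ∑ e ∈ S, z e := by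
  refine Finset.sum_subset (fun e he => (hS e).1 (Finset.mem_filter.1 he).2) fun e he he' => ?_
  refine hz e fun hF => he' (Finset.mem_filter.2 ⟨hF, (hS e).2 he⟩)

theorem isEdgeFlow_iff {A : Type*} [AddCommGroup A] {T : (ℤ × ℤ) × Fin 3 → Prop}
    (hU : ∀ w j j', T (upEdge w j) → T (upEdge w j') → j = j')
    (hD : ∀ w j j', T (dnEdge w j) → T (dnEdge w j') → j = j')
    {F : Finset ((ℤ × ℤ) × Fin 3)} {z : (ℤ × ℤ) × Fin 3 → A} (hz : ∀ e ∉ F, z e = 0) :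
    (∀ n, ∑ e ∈ F with upNode T e = n, z e = ∑ e ∈ F with dnNode T e = n, z e) ↔
      IsEdgeFlow T z := by
  classical
  have u1 : ∀ e₀ j, ∑ e ∈ F with upNode T e = Sum.inl (e₀, j), z e =
      ∑ e ∈ if T e₀ then {upEdge (upTri e₀) j} else ∅, z e := by
    refine fun e₀ j => sum_filter_eq_of_support hz _ _ _ fun e => ?_
    have := gluedNode_eq_inl upTri_upEdge upEdge_upTri (fun _ _ => rfl) hU e e₀ j
    rw [upNode_eq_inl, this]; split_ifs <;> simp_all
  have d1 : ∀ e₀ j, ∑ e ∈ F with dnNode T e = Sum.inl (e₀, j), z e =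
      ∑ e ∈ if T e₀ then {dnEdge (dnTri e₀) j} else ∅, z e := by
    refine fun e₀ j => sum_filter_eq_of_support hz _ _ _ fun e => ?_
    have := gluedNode_eq_inl dnTri_dnEdge dnEdge_dnTri (fun _ _ => rfl) hD e e₀ j
    rw [dnNode_eq_inl, this]; split_ifs <;> simp_all
  have u2 : ∀ w, ∑ e ∈ F with upNode T e = Sum.inr (Sum.inl w), z e =
      ∑ e ∈ if ∃ j, T (upEdge w j) then ∅ else Finset.univ.image (upEdge w), z e := by
    refine fun w => sum_filter_eq_of_support hz _ _ _ fun e => ?_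
    have := gluedNode_eq_inr (T := T) upTri_upEdge upEdge_upTri e w
    rw [upNode_eq_inr, this]; split_ifs <;> simp_all [eq_comm]
  have d2 : ∀ w, ∑ e ∈ F with dnNode T e = Sum.inr (Sum.inr w), z e =
      ∑ e ∈ if ∃ j, T (dnEdge w j) then ∅ else Finset.univ.image (dnEdge w), z e := by
    refine fun w => sum_filter_eq_of_support hz _ _ _ fun e => ?_
    have := gluedNode_eq_inr (T := T) dnTri_dnEdge dnEdge_dnTri e w
    rw [dnNode_eq_inr, this]; split_ifs <;> simp_all [eq_comm]
  have u3 : ∀ w, ∑ e ∈ F with upNode T e = Sum.inr (Sum.inr w), z e = 0 := by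
    refine fun w => Finset.sum_eq_zero fun e he => ?_
    have := (Finset.mem_filter.1 he).2
    unfold upNode at this
    cases h : gluedNode T upTri upEdge e <;> simp [h] at this
  have d3 : ∀ w, ∑ e ∈ F with dnNode T e = Sum.inr (Sum.inl w), z e = 0 := by
    refine fun w => Finset.sum_eq_zero fun e he => ?_
    have := (Finset.mem_filter.1 he).2
    unfold dnNode at this
    cases h : gluedNode T dnTri dnEdge e <;> simp [h] at this
  have iu : ∀ w, ∑ e ∈ Finset.univ.image (upEdge w), z e = ∑ j, z (upEdge w j) := fun w =>
    Finset.sum_image fun j _ j' _ h => congrArg Prod.snd h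
  have id' : ∀ w, ∑ e ∈ Finset.univ.image (dnEdge w), z e = ∑ j, z (dnEdge w j) := fun w =>
    Finset.sum_image fun j _ j' _ h => congrArg Prod.snd h
  constructor
  · intro h
    refine ⟨fun w hw => ?_, fun w hw => ?_, fun e he j => ?_⟩
    · have := h (Sum.inr (Sum.inl w))
      rwa [u2, d3, if_neg hw, iu] at this
    · have := h (Sum.inr (Sum.inr w))
      rw [u3, d2, if_neg hw, id'] at this
      exact this.symm
    · have := h (Sum.inl (e, j))
      rwa [u1, d1, if_pos he, if_pos he, Finset.sum_singleton, Finset.sum_singleton] at this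
  · rintro ⟨h1, h2, h3⟩ (⟨e, j⟩ | w | w)
    · rw [u1, d1]
      split_ifs with he
      · simpa using h3 e he j
      · rfl
    · rw [u2, d3]
      split_ifs with hw
      · rfl
      · rw [iu, h1 w hw]
    · rw [u3, d2]
      split_ifs with hw
      · rfl
      · rw [id', h2 w hw]

/-- A nonzero edge flow with values in an abelian group gives a nonzero real edge flow. -/
theorem exists_real_isEdgeFlow {A : Type*} [AddCommGroup A] {T : (ℤ × ℤ) × Fin 3 → Prop}
    (hU : ∀ w j j', T (upEdge w j) → T (upEdge w j') → j = j')
    (hD : ∀ w j j', T (dnEdge w j) → T (dnEdge w j') → j = j')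
    {F : Finset ((ℤ × ℤ) × Fin 3)} {z : (ℤ × ℤ) × Fin 3 → A} (hz : ∀ e ∉ F, z e = 0)
    (hf : IsEdgeFlow T z) (hne : ∃ e, z e ≠ 0) :
    ∃ y : (ℤ × ℤ) × Fin 3 → ℝ, (∀ e ∉ F, y e = 0) ∧ (∃ e ∈ F, y e ≠ 0) ∧ IsEdgeFlow T y := by
  classical
  obtain ⟨e, he⟩ := hne
  obtain ⟨y, hy, hy', hyf⟩ := exists_real_circulation F (upNode T) (dnNode T) z
    ((isEdgeFlow_iff hU hD hz).2 hf) ⟨e, by_contra fun h => he (hz e h), he⟩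
  exact ⟨y, hy, hy', (isEdgeFlow_iff hU hD hy).1 hyf⟩

/-- Differences of a function on the lattice along edges, signed so that they sum to zero over
each unit triangle. -/
def edgeDiff {A : Type*} [AddCommGroup A] (f : ℤ × ℤ → A) (e : (ℤ × ℤ) × Fin 3) : A :=
  if e.2 = 0 then f (e.1 + (1, 0)) - f e.1
  else if e.2 = 1 then f e.1 - f (e.1 + (1, 1))
  else f (e.1 + (0, 1)) - f e.1

section

variable {A : Type*} [AddCommGroup A]

theorem sum_edgeDiff_up (f : ℤ × ℤ → A) (w : ℤ × ℤ) : ∑ j, edgeDiff f (upEdge w j) = 0 := by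
  have : w + (1, 0) + (0, 1) = w + (1, 1) := by rw [add_assoc]; rfl
  simp [Fin.sum_univ_three, edgeDiff, upEdge, this]

theorem sum_edgeDiff_dn (f : ℤ × ℤ → A) (w : ℤ × ℤ) : ∑ j, edgeDiff f (dnEdge w j) = 0 := by
  have : w + (0, 1) + (1, 0) = w + (1, 1) := by rw [add_assoc]; rfl
  simp [Fin.sum_univ_three, edgeDiff, dnEdge, this]

/-- The direction in `Fin 6` of an edge. -/
def dir6 (j : Fin 3) : Fin 6 := j.castLE (by norm_num)

theorem rhomb_eq_zero_iff (f : ℤ × ℤ → A) (e : (ℤ × ℤ) × Fin 3) (j : Fin 3) (hj : j ≠ e.2) :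
    rhomb f e.1 (dir6 e.2) = 0 ↔
      edgeDiff f (upEdge (upTri e) j) = edgeDiff f (dnEdge (dnTri e) j) := by
  obtain ⟨⟨a, b⟩, i⟩ := e
  fin_cases i <;> fin_cases j <;>
    simp [rhomb, dir6, hexDir, edgeDiff, upEdge, upTri, dnEdge, dnTri] at hj ⊢ <;>
    constructor <;> intro h <;> grind

end

theorem edgeDiff_eq_zero {A : Type*} [AddCommGroup A] {r : ℕ} {f : ℤ × ℤ → A}
    (hf : ∀ v, ¬ InInt r v → f v = 0) {e : (ℤ × ℤ) × Fin 3}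
    (he : ¬ InnerEdge r e.1 (dir6 e.2)) : edgeDiff f e = 0 := by
  have h1 : f e.1 = 0 := hf _ fun h => he (h.innerEdge _)
  have h2 : f (e.1 + hexDir (dir6 e.2)) = 0 := hf _ fun h => he (by
    have := (h.innerEdge (dir6 e.2 + 3)).opp
    rwa [(add_hexDir_opp _ _).1, (by decide : ∀ i : Fin 6, i + 3 + 3 = i)] at this)
  obtain ⟨v, i⟩ := e
  fin_cases i <;> simp [edgeDiff, dir6, hexDir] at h1 h2 ⊢ <;> simp [h1, h2]

/-- A closed edge function vanishing outside the triangle is the difference of a function. -/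
theorem exists_edgeDiff_eq {A : Type*} [AddCommGroup A] {r : ℕ} {y : (ℤ × ℤ) × Fin 3 → A}
    (hup : ∀ w, ∑ j, y (upEdge w j) = 0) (hdn : ∀ w, ∑ j, y (dnEdge w j) = 0)
    (hy : ∀ e : (ℤ × ℤ) × Fin 3, ¬ InnerEdge r e.1 (dir6 e.2) → y e = 0) :
    ∃ g : ℤ × ℤ → A, (∀ v, ¬ InInt r v → g v = 0) ∧ ∀ e, edgeDiff g e = y e := by
  set g : ℤ × ℤ → A := fun v => ∑ j ∈ Finset.Ico 0 v.1, y ((j, v.2), 0) with hg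
  have s0 : ∀ k i : ℤ, g (k + 1, i) = g (k, i) + y ((k, i), 0) := by
    intro k i
    rcases le_or_gt 0 k with hk | hk
    · simp only [hg]
      rw [← Finset.insert_Ico_right_eq_Ico_add_one hk, Finset.sum_insert (by simp), add_comm]
    · rw [hy _ (by simp [InnerEdge, InTri]; omega)]
      simp only [hg]
      rw [Finset.Ico_eq_empty (by omega), Finset.Ico_eq_empty (by omega)]
      simp
  have up : ∀ k i : ℤ, y ((k, i), 0) + y ((k, i), 1) + y ((k + 1, i), 2) = 0 := by
    intro k i
    simpa [Fin.sum_univ_three, upEdge] using hup (k, i)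
  have dn : ∀ k i : ℤ, y ((k, i + 1), 0) + y ((k, i), 1) + y ((k, i), 2) = 0 := by
    intro k i
    simpa [Fin.sum_univ_three, dnEdge] using hdn (k, i)
  have s2 : ∀ k i : ℤ, g (k, i + 1) = g (k, i) + y ((k, i), 2) := by
    intro k i
    rcases le_or_gt 0 k with hk | hk
    · induction k, hk using Int.leInduction with
      | base =>
        rw [hy _ (by simp [InnerEdge, InTri, hexDir, dir6])]
        simp [hg]
      | succ k hk ih =>
        rw [s0, s0, ih]
        have h1 := up k i
        have h2 := dn k i
        have : y ((k, i + 1), 0) + y ((k, i), 2) = y ((k, i), 0) + y ((k + 1, i), 2) := by grind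
        rw [add_assoc, add_comm (y ((k, i), 2)), this, add_assoc]
    · rw [hy _ (by simp [InnerEdge, InTri]; omega)]
      simp only [hg]
      rw [Finset.Ico_eq_empty (by omega)]
      simp
  have s1 : ∀ k i : ℤ, g (k, i) = g (k + 1, i + 1) + y ((k, i), 1) := by
    intro k i
    rw [s2, s0]
    have := up k i
    grind
  refine ⟨g, ?_, ?_⟩
  · have big : ∀ k i : ℤ, (r : ℤ) ≤ i → g (k, i) = 0 := by
      intro k i hi
      refine Finset.sum_eq_zero fun j _ => hy _ ?_
      simp [InnerEdge, InTri, hexDir, dir6]; omega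
    have diag : ∀ m : ℕ, ∀ k i : ℤ, i ≤ k → r ≤ i + m → g (k, i) = 0 := by
      intro m
      induction m with
      | zero => intro k i _ h; exact big k i (by simpa using h)
      | succ m ih =>
        intro k i hki h
        rw [s1, ih _ _ (by omega) (by push_cast at h; omega),
          hy _ (by simp [InnerEdge, InTri, hexDir, dir6]; omega), add_zero]
    rintro ⟨k, i⟩ hv
    simp only [InInt, not_and, not_lt] at hv
    rcases le_or_gt k 0 with hk | hk
    · simp only [hg]; rw [Finset.Ico_eq_empty (by omega)]; rfl
    · rcases le_or_gt i k with hi | hi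
      · exact diag (r - i).toNat k i hi (by omega)
      · exact big k i (hv hk hi)
  · rintro ⟨⟨k, i⟩, j⟩
    fin_cases j
    · simp [edgeDiff, s0 k i]
    · have := s1 k i
      simp [edgeDiff]
      grind
    · simp [edgeDiff, s2 k i]

section

variable {r : ℕ} {h : ℤ × ℤ → ℝ}

/-- Tightness of an unoriented edge. -/
def TightEdge (r : ℕ) (h : ℤ × ℤ → ℝ) (e : (ℤ × ℤ) × Fin 3) : Prop :=
  Tight r h e.1 (dir6 e.2)

theorem TightEdge.up_unique (hN : ∀ v i, ¬ (Tight r h v i ∧ Tight r h v (i + 1)))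
    (w : ℤ × ℤ) (j j' : Fin 3) (h1 : TightEdge r h (upEdge w j))
    (h2 : TightEdge r h (upEdge w j')) : j = j' := by
  have a : TightEdge r h (upEdge w 0) → Tight r h w 0 ∧ Tight r h (w + hexDir 0) 3 :=
    fun ht => ⟨ht, Tight.opp ht⟩
  have b : TightEdge r h (upEdge w 1) → Tight r h w 1 ∧ Tight r h (w + hexDir 1) 4 :=
    fun ht => ⟨ht, Tight.opp ht⟩
  have e : w + hexDir 0 + hexDir 2 = w + hexDir 1 := by rw [add_assoc]; rfl
  have c : TightEdge r h (upEdge w 2) →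
      Tight r h (w + hexDir 0) 2 ∧ Tight r h (w + hexDir 1) 5 :=
    fun ht => ⟨ht, e ▸ Tight.opp ht⟩
  have n1 := hN w 0
  have n2 := hN (w + hexDir 1) 4
  have n3 := hN (w + hexDir 0) 2
  fin_cases j <;> fin_cases j' <;> simp at h1 h2 ⊢ <;> simp_all

theorem TightEdge.dn_unique (hN : ∀ v i, ¬ (Tight r h v i ∧ Tight r h v (i + 1)))
    (w : ℤ × ℤ) (j j' : Fin 3) (h1 : TightEdge r h (dnEdge w j))
    (h2 : TightEdge r h (dnEdge w j')) : j = j' := by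
  have e : w + hexDir 2 + hexDir 0 = w + hexDir 1 := by rw [add_assoc]; rfl
  have a : TightEdge r h (dnEdge w 0) →
      Tight r h (w + hexDir 2) 0 ∧ Tight r h (w + hexDir 1) 3 :=
    fun ht => ⟨ht, e ▸ Tight.opp ht⟩
  have b : TightEdge r h (dnEdge w 1) → Tight r h w 1 ∧ Tight r h (w + hexDir 1) 4 :=
    fun ht => ⟨ht, Tight.opp ht⟩
  have c : TightEdge r h (dnEdge w 2) → Tight r h w 2 ∧ Tight r h (w + hexDir 2) 5 :=
    fun ht => ⟨ht, Tight.opp ht⟩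
  have n1 := hN w 1
  have n2 := hN (w + hexDir 1) 3
  have n3 := hN (w + hexDir 2) 5
  fin_cases j <;> fin_cases j' <;> simp at h1 h2 ⊢ <;> simp_all

theorem rhomb_eq_zero_of_edge {A : Type*} [AddCommGroup A] {g : ℤ × ℤ → A}
    (hg : ∀ e : (ℤ × ℤ) × Fin 3, TightEdge r h e → rhomb g e.1 (dir6 e.2) = 0)
    (v : ℤ × ℤ) (i : Fin 6) (ht : Tight r h v i) : rhomb g v i = 0 := by
  rcases (by decide : ∀ i : Fin 6, ∃ j : Fin 3, i = dir6 j ∨ i + 3 = dir6 j) i with ⟨j, rfl | hj⟩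
  · exact hg (v, j) ht
  · rw [← rhomb_opp, hj]
    exact hg (_, j) (by unfold TightEdge; rw [← hj]; exact ht.opp)

/-- The rigidity of a maximal vertex holds with coefficients in any abelian group. -/
theorem IsMaxVertex.eq_zero_of_addCommGroup (hm : IsMaxVertex r h) (hs : StrictBdry r h)
    {A : Type*} [AddCommGroup A] {f : ℤ × ℤ → A} (hf : ∀ v, ¬ InInt r v → f v = 0)
    (hft : ∀ v i, Tight r h v i → rhomb f v i = 0) : f = 0 := by
  classical
  have hU := TightEdge.up_unique (hm.not_consecutive hs)
  have hD := TightEdge.dn_unique (hm.not_consecutive hs)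
  have hU' : ∀ e, TightEdge r h e → ∀ j ≠ e.2, ¬ TightEdge r h (upEdge (upTri e) j) :=
    fun e he j hj h' => hj (hU _ _ _ h' (by rwa [upEdge_upTri]))
  have hD' : ∀ e, TightEdge r h e → ∀ j ≠ e.2, ¬ TightEdge r h (dnEdge (dnTri e) j) :=
    fun e he j hj h' => hj (hD _ _ _ h' (by rwa [dnEdge_dnTri]))
  set z : (ℤ × ℤ) × Fin 3 → A := fun e => if TightEdge r h e then 0 else edgeDiff f e with hz
  have hzf : IsEdgeFlow (TightEdge r h) z := by
    refine ⟨fun w hw => ?_, fun w hw => ?_, fun e he j => ?_⟩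
    · rw [← sum_edgeDiff_up f w]
      exact Finset.sum_congr rfl fun j _ => if_neg fun hj => hw ⟨j, hj⟩
    · rw [← sum_edgeDiff_dn f w]
      exact Finset.sum_congr rfl fun j _ => if_neg fun hj => hw ⟨j, hj⟩
    · rcases eq_or_ne j e.2 with rfl | hj
      · rw [upEdge_upTri, dnEdge_dnTri]
      · simp only [hz, if_neg (hU' e he j hj), if_neg (hD' e he j hj)]
        exact (rhomb_eq_zero_iff f e j hj).1 (hft _ _ he)
  have hfin : {e : (ℤ × ℤ) × Fin 3 | InnerEdge r e.1 (dir6 e.2) ∧ ¬ TightEdge r h e}.Finite := by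
    refine ((triPts r ×ˢ (Finset.univ : Finset (Fin 3))).finite_toSet).subset ?_
    rintro ⟨v, i⟩ h
    simpa [mem_triPts] using h.1.1
  have hF : ∀ e ∉ hfin.toFinset, z e = 0 := by
    intro e he
    simp only [Set.Finite.mem_toFinset, Set.mem_ofPred_eq, not_and, not_not] at he
    simp only [hz]
    split_ifs with ht
    · rfl
    · exact edgeDiff_eq_zero hf fun hi => ht (he hi)
  by_cases hne : ∃ e, z e ≠ 0
  · exfalso
    obtain ⟨y, hy, ⟨e₀, he₀, hye₀⟩, hyf⟩ := exists_real_isEdgeFlow hU hD hF hzf hne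
    have hyT : ∀ e, TightEdge r h e → y e = 0 := fun e he => hy e (by simp [he])
    set Y : (ℤ × ℤ) × Fin 3 → ℝ := fun e =>
      y e - if TightEdge r h e then ∑ j, y (upEdge (upTri e) j) else 0 with hY
    have hYup : ∀ w, ∑ j, Y (upEdge w j) = 0 := by
      intro w
      simp only [hY, Finset.sum_sub_distrib, upTri_upEdge]
      by_cases hw : ∃ j, TightEdge r h (upEdge w j)
      · obtain ⟨j, hj⟩ := hw
        rw [Finset.sum_eq_single j (f := fun j' => if TightEdge r h (upEdge w j') then _ else _)
          (fun j' _ hj' => if_neg fun ht => hj' (hU _ _ _ ht hj)) (by simp), if_pos hj, sub_self]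
      · rw [hyf.up w hw, Finset.sum_eq_zero fun j _ => if_neg fun hj => hw ⟨j, hj⟩, sub_self]
    have hYdn : ∀ w, ∑ j, Y (dnEdge w j) = 0 := by
      intro w
      simp only [hY, Finset.sum_sub_distrib]
      by_cases hw : ∃ j, TightEdge r h (dnEdge w j)
      · obtain ⟨j, hj⟩ := hw
        rw [Finset.sum_eq_single j (f := fun j' => if TightEdge r h (dnEdge w j') then _ else _)
          (fun j' _ hj' => if_neg fun ht => hj' (hD _ _ _ ht hj)) (by simp), if_pos hj,
          sub_eq_zero]
        refine Finset.sum_congr rfl fun j' _ => ?_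
        rw [hyf.opp _ hj, dnTri_dnEdge]
      · rw [hyf.dn w hw, Finset.sum_eq_zero fun j _ => if_neg fun hj => hw ⟨j, hj⟩, sub_self]
    have hY0 : ∀ e : (ℤ × ℤ) × Fin 3, ¬ InnerEdge r e.1 (dir6 e.2) → Y e = 0 := by
      intro e he
      simp only [hY]
      rw [hy e (by simp [he]), if_neg fun ht => he ht.1, sub_self]
    obtain ⟨g, hg0, hg⟩ := exists_edgeDiff_eq hYup hYdn hY0
    have hg' : g = 0 := by
      refine hm.eq_zero g hg0 (rhomb_eq_zero_of_edge fun e he => ?_)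
      obtain ⟨j, hj⟩ : ∃ j, j ≠ e.2 := ⟨e.2 + 1, by simp⟩
      rw [rhomb_eq_zero_iff g e j hj, hg, hg]
      simp only [hY]
      rw [if_neg (hU' e he j hj), if_neg (hD' e he j hj), hyf.opp e he]
    have := hg e₀
    simp only [Set.Finite.mem_toFinset, Set.mem_ofPred_eq] at he₀
    simp only [hY, if_neg he₀.2, sub_zero, hg'] at this
    exact hye₀ (by rw [← this]; simp [edgeDiff])
  · push Not at hne
    have hd : ∀ e, ¬ TightEdge r h e → edgeDiff f e = 0 := fun e he => by
      simpa [hz, he] using hne e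
    have hd' : ∀ e, edgeDiff f e = 0 := by
      intro e
      by_cases he : TightEdge r h e
      · have := sum_edgeDiff_up f (upTri e)
        rwa [Finset.sum_eq_single e.2 (fun j _ hj => hd _ (hU' e he j hj)) (by simp),
          upEdge_upTri] at this
      · exact hd e he
    have hstep : ∀ m : ℕ, ∀ k i : ℤ, f (k, i) = f (k + m, i) := by
      intro m
      induction m with
      | zero => simp
      | succ m ih =>
        intro k i
        have := hd' ((k + m, i), 0)
        simp [edgeDiff, sub_eq_zero] at this
        rw [ih, ← this, Nat.cast_succ, add_assoc]
    funext ⟨k, i⟩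
    rw [hstep (i - k).toNat]
    exact hf _ (by simp [InInt]; omega)

end

/-- A hive with integral boundary values can be replaced by an integral hive with the same
boundary values. -/
theorem exists_integral_hive {r : ℕ} {b : ℤ × ℤ → ℝ} (hb : IsHive r b)
    (hint : ∀ v, ¬ InInt r v → ∃ n : ℤ, b v = n) :
    ∃ h ∈ hiveSet r b, ∀ v, ∃ n : ℤ, h v = n := by
  have hpos : ∀ n : ℕ, (0 : ℝ) < 1 / ((n : ℝ) + 1) := fun n => by positivity
  choose h hh hm using fun n : ℕ => exists_isMaxVertex (isHive_add_quadHive hb (hpos n)).1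
  have hs : ∀ n, StrictBdry r (h n) := fun n =>
    (isHive_add_quadHive hb (hpos n)).2.congr (hh n).2
  obtain ⟨P, hP⟩ : ∃ P : Set ((ℤ × ℤ) × Fin 6), ∃ᶠ n in Filter.atTop,
      {p : (ℤ × ℤ) × Fin 6 | Tight r (h n) p.1 p.2} = P := by
    by_contra hc
    simp only [not_exists, Filter.not_frequently] at hc
    have := (Filter.eventually_all_finite (finite_innerEdge r).finite_subsets).2
      fun P _ => hc P
    obtain ⟨n, hn⟩ := this.exists
    exact hn _ (fun p hp => hp.1) rfl
  obtain ⟨φ, hφ, hφP⟩ := Filter.extraction_of_frequently_atTop hP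
  obtain ⟨M, hM⟩ := exists_hive_bound r (∑ v ∈ triPts r, (|b v| + |quadHive v|))
  have hbd : ∀ (n : ℕ) (v), |(b + (1 / ((n : ℝ) + 1)) • quadHive) v| ≤ |b v| + |quadHive v| := by
    intro n v
    refine (abs_add_le _ _).trans (add_le_add le_rfl ?_)
    simp only [Pi.smul_apply, smul_eq_mul, abs_mul]
    have : |1 / ((n : ℝ) + 1)| ≤ 1 := by
      rw [abs_of_pos (hpos n), div_le_one (by positivity)]
      linarith [(Nat.cast_nonneg n : (0 : ℝ) ≤ n)]
    nlinarith [abs_nonneg (quadHive v)]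
  have hcomp : IsCompact (Set.pi Set.univ fun v : ℤ × ℤ =>
      Set.Icc (-(max M (|b v| + |quadHive v|))) (max M (|b v| + |quadHive v|))) :=
    isCompact_univ_pi fun v => isCompact_Icc
  obtain ⟨g, -, ψ, hψ, hlim⟩ := hcomp.tendsto_subseq (x := fun n => h (φ n)) (by
    intro n v _
    refine abs_le.1 (?_ : |h (φ n) v| ≤ _)
    by_cases hv : InInt r v
    · refine (hM _ (hm _).hive (fun w hw hw' => ?_) v hv.inTri).trans (le_max_left _ _)
      rw [(hh _).2 w hw']
      exact (hbd _ w).trans (Finset.single_le_sum (f := fun v => |b v| + |quadHive v|)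
        (fun _ _ => by positivity) (mem_triPts.2 hw))
    · rw [(hh _).2 v hv]
      exact (hbd _ v).trans (le_max_right _ _))
  have hlim' : ∀ v, Filter.Tendsto (fun n => h (φ (ψ n)) v) Filter.atTop (nhds (g v)) :=
    tendsto_pi_nhds.1 hlim
  have hgb : ∀ v, ¬ InInt r v → g v = b v := by
    intro v hv
    refine tendsto_nhds_unique (hlim' v) ?_
    have e : ∀ n, h (φ (ψ n)) v = b v + 1 / (((φ (ψ n) : ℕ) : ℝ) + 1) * quadHive v :=
      fun n => by rw [(hh _).2 v hv]; rfl
    simp only [e]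
    have t := (tendsto_one_div_add_atTop_nhds_zero_nat (𝕜 := ℝ)).comp
      (hφ.comp hψ).tendsto_atTop
    simpa using (t.mul_const (quadHive v)).const_add (b v)
  have hgh : IsHive r g := (isClosed_isHive r).mem_of_tendsto hlim
    (Filter.Eventually.of_forall fun n => (hm _).hive)
  have hgP : ∀ p ∈ P, rhomb g p.1 p.2 = 0 := by
    intro p hp
    have t := ((continuous_rhomb p.1 p.2).tendsto g).comp hlim
    refine tendsto_nhds_unique t (tendsto_const_nhds.congr fun n => ?_)
    rw [← hφP (ψ n)] at hp
    exact hp.2.symm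
  refine ⟨g, ⟨hgh, hgb⟩, ?_⟩
  let q : ℝ →+ AddCircle (1 : ℝ) := QuotientAddGroup.mk' _
  have hq : ∀ x : ℝ, q x = 0 ↔ ∃ n : ℤ, x = n := by
    intro x
    have := AddCircle.coe_eq_zero_iff (1 : ℝ) (x := x)
    simp only [zsmul_eq_mul, mul_one] at this
    exact this.trans (exists_congr fun n => eq_comm)
  have h0 := (hm (φ 0)).eq_zero_of_addCommGroup (hs (φ 0)) (f := fun v => q (g v))
    (fun v hv => by rw [hq, hgb v hv]; exact hint v hv) (fun v i ht => by
      rw [rhomb_map, hgP (v, i) (by rw [← hφP 0]; exact ht), map_zero])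
  exact fun v => (hq _).1 (congrFun h0 v)

/-! ### Chains of partitions and the lattice word condition -/

/-- The sequence `p` interlaces `q`, i.e. `q / p` is a horizontal strip. -/
def Interl (p q : ℕ → ℤ) : Prop := ∀ i, p i ≤ q i ∧ q (i + 1) ≤ p i

/-- The sequence `p` is a partition with at most `r` parts. -/
structure IsPart (r : ℕ) (p : ℕ → ℤ) : Prop where
  anti : ∀ i, p (i + 1) ≤ p i
  nonneg : ∀ i, 0 ≤ p i
  eq_zero : ∀ i, r ≤ i → p i = 0

/-- A chain of `n` horizontal strips ending in `lam`. -/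
structure IsChainTo (r n : ℕ) (lam : ℕ → ℤ) (x : ℕ → ℕ → ℤ) : Prop where
  last : ∀ k, n ≤ k → x k = lam
  interl : ∀ k, k < n → Interl (x k) (x (k + 1))
  nonneg : ∀ k i, 0 ≤ x k i
  eq_zero : ∀ k i, r ≤ i → x k i = 0

/-- Partial sums of a sequence. -/
def psum (p : ℕ → ℤ) (i : ℕ) : ℤ := ∑ j ∈ Finset.range i, p j

@[simp] theorem psum_zero (p : ℕ → ℤ) : psum p 0 = 0 := by simp [psum]

theorem psum_succ (p : ℕ → ℤ) (i : ℕ) : psum p (i + 1) = psum p i + p i := by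
  simp [psum, Finset.sum_range_succ]

theorem psum_congr {p q : ℕ → ℤ} {i : ℕ} (h : ∀ j < i, p j = q j) : psum p i = psum q i :=
  Finset.sum_congr rfl fun j hj => h j (Finset.mem_range.1 hj)

theorem psum_le {p q : ℕ → ℤ} {i : ℕ} (h : ∀ j, p j ≤ q j) : psum p i ≤ psum q i :=
  Finset.sum_le_sum fun j _ => h j

/-- The excess of the `k`-th letter in the rows before `i` over the next letter in the rows up to
`i`; these are all nonnegative exactly for Littlewood–Richardson tableaux. -/
def latticeGap (x : ℕ → ℕ → ℤ) (k i : ℕ) : ℤ :=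
  (psum (x (k + 1)) i - psum (x k) i) - (psum (x (k + 2)) (i + 1) - psum (x (k + 1)) (i + 1))

/-- The first row `i` at which the lattice condition fails, and the largest letter `k` for which
it fails there. -/
def FirstFail (x : ℕ → ℕ → ℤ) (i k : ℕ) : Prop :=
  latticeGap x k i < 0 ∧ (∀ i' < i, ∀ k', 0 ≤ latticeGap x k' i') ∧
    ∀ k', k < k' → 0 ≤ latticeGap x k' i

theorem FirstFail.unique {x : ℕ → ℕ → ℤ} {i k i' k' : ℕ} (h : FirstFail x i k)
    (h' : FirstFail x i' k') : i = i' ∧ k = k' := by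
  have hi : i = i' := by
    rcases lt_trichotomy i i' with hlt | heq | hlt
    · exact absurd h.1 (not_lt.2 (h'.2.1 _ hlt _))
    · exact heq
    · exact absurd h'.1 (not_lt.2 (h.2.1 _ hlt _))
  subst hi
  rcases lt_trichotomy k k' with hlt | heq | hlt
  · exact absurd h'.1 (not_lt.2 (h.2.2 _ hlt))
  · exact ⟨rfl, heq⟩
  · exact absurd h.1 (not_lt.2 (h'.2.2 _ hlt))

/-- The row obtained from `y`, which is interlaced between `p` and `q`, by reflecting the parts
after `i` and making the part `i` compensate for the gap `d`. -/
def reflectRow (p y q : ℕ → ℤ) (i : ℕ) (d : ℤ) (j : ℕ) : ℤ :=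
  if j < i then y j else if j = i then max (q (j + 1)) (p j) - d - 1
  else max (q (j + 1)) (p j) + min (q j) (p (j - 1)) - y j

/-- The Bender–Knuth type move at row `i` and letter `k`. -/
def flipAt (x : ℕ → ℕ → ℤ) (i k : ℕ) : ℕ → ℕ → ℤ :=
  Function.update x (k + 1) (reflectRow (x k) (x (k + 1)) (x (k + 2)) i (latticeGap x k i))

section

variable {r n : ℕ} {lam : ℕ → ℤ} {x : ℕ → ℕ → ℤ} {i k : ℕ}

theorem IsChainTo.lt_of_gap_neg (hx : IsChainTo r n lam x) (h : latticeGap x k i < 0) :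
    k + 1 < n := by
  by_contra hk
  push Not at hk
  have e1 := hx.last (k + 1) hk
  have e2 := hx.last (k + 2) (by omega)
  unfold latticeGap at h
  rw [e1, e2] at h
  rcases Nat.lt_or_ge k n with hk' | hk'
  · have := hx.interl k hk'
    rw [e1] at this
    have := psum_le (i := i) fun j => (this j).1
    omega
  · rw [hx.last k hk'] at h
    omega

theorem IsChainTo.exists_firstFail (hx : IsChainTo r n lam x)
    (h : ∃ k i, latticeGap x k i < 0) : ∃ i k, FirstFail x i k := by
  classical
  have h' : ∃ i, ∃ k, latticeGap x k i < 0 := by obtain ⟨k, i, h⟩ := h; exact ⟨i, k, h⟩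
  refine ⟨Nat.find h', Nat.findGreatest (fun k => latticeGap x k (Nat.find h') < 0) n, ?_, ?_, ?_⟩
  · obtain ⟨k, hk⟩ := Nat.find_spec h'
    exact Nat.findGreatest_spec (P := fun k => latticeGap x k (Nat.find h') < 0)
      (by have := hx.lt_of_gap_neg hk; omega : k ≤ n) hk
  · intro i hi k
    by_contra hc
    exact Nat.find_min h' hi ⟨k, not_le.1 hc⟩
  · intro k hk
    by_contra hc
    have := hx.lt_of_gap_neg (not_le.1 hc)
    exact Nat.findGreatest_is_greatest hk (by omega) (not_le.1 hc)

theorem FirstFail.gap_bounds (h : FirstFail x i k) (h0 : Interl (x k) (x (k + 1)))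
    (h1 : Interl (x (k + 1)) (x (k + 2))) :
    x (k + 1) i - latticeGap x k i ≤ x (k + 2) i ∧
      ∀ j, i = j + 1 → x (k + 1) i - latticeGap x k i ≤ x k j := by
  have key : ∀ j, i = j + 1 → x (k + 1) i - latticeGap x k i ≤
      x (k + 2) i - (x (k + 1) j - x k j) := by
    rintro j rfl
    have := h.2.1 j (by omega) k
    unfold latticeGap at *
    simp only [psum_succ] at *
    linarith
  refine ⟨?_, fun j hj => ?_⟩
  · rcases Nat.eq_zero_or_pos i with rfl | hi
    · simp [latticeGap, psum_succ]
    · have := key (i - 1) (by omega)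
      have := (h0 (i - 1)).1
      omega
  · have := key j hj
    subst hj
    have := (h1 j).2
    omega

section reflectRow

variable {p y q : ℕ → ℤ} {d : ℤ}

theorem reflectRow_of_lt {j : ℕ} (hj : j < i) : reflectRow p y q i d j = y j := by
  simp [reflectRow, hj]

theorem reflectRow_self : reflectRow p y q i d i = max (q (i + 1)) (p i) - d - 1 := by
  simp [reflectRow]

theorem reflectRow_of_gt {j : ℕ} (hj : i < j) :
    reflectRow p y q i d j = max (q (j + 1)) (p j) + min (q j) (p (j - 1)) - y j := by
  simp [reflectRow, hj.ne', hj.le]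

theorem interl_reflectRow (hpy : Interl p y) (hyq : Interl y q) (hd : d < 0)
    (h1 : y i - d ≤ q i) (h2 : ∀ j, i = j + 1 → y i - d ≤ p j) :
    Interl p (reflectRow p y q i d) ∧ Interl (reflectRow p y q i d) q := by
  have hl : ∀ j, p j ≤ reflectRow p y q i d j ∧ q (j + 1) ≤ reflectRow p y q i d j ∧
      reflectRow p y q i d j ≤ q j := by
    intro j
    have a1 := hpy j
    have a2 := hyq j
    rcases lt_trichotomy j i with hj | rfl | hj
    · rw [reflectRow_of_lt hj]
      omega
    · rw [reflectRow_self]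
      omega
    · rw [reflectRow_of_gt hj]
      have a3 := hpy (j - 1)
      rw [Nat.sub_add_cancel (by omega)] at a3
      omega
  have hu : ∀ j, reflectRow p y q i d (j + 1) ≤ p j := by
    intro j
    have a1 := hpy j
    have b1 := hpy (j + 1)
    have b2 := hyq (j + 1)
    rcases lt_trichotomy (j + 1) i with hj | hj | hj
    · rw [reflectRow_of_lt hj]
      omega
    · have := h2 j hj.symm
      subst hj
      rw [reflectRow_self]
      omega
    · rw [reflectRow_of_gt hj, Nat.add_sub_cancel]
      omega
  exact ⟨fun j => ⟨(hl j).1, hu j⟩, fun j => ⟨(hl j).2.2, (hl j).2.1⟩⟩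

theorem psum_reflectRow_of_le {m : ℕ} (hm : m ≤ i) :
    psum (reflectRow p y q i d) m = psum y m :=
  psum_congr fun _ hj => reflectRow_of_lt (by omega)

theorem psum_reflectRow (hd : d = psum y i - psum p i - (psum q (i + 1) - psum y (i + 1)))
    {m : ℕ} (hm : i ≤ m) :
    psum (reflectRow p y q i d) (m + 1) + psum y (m + 1) =
      psum p m + psum q (m + 1) - 1 + max (q (m + 1)) (p m) := by
  induction m, hm using Nat.le_induction with
  | base =>
    rw [psum_succ, psum_reflectRow_of_le le_rfl, reflectRow_self]
    omega
  | succ m hm ih =>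
    rw [psum_succ _ (m + 1), psum_succ y (m + 1), reflectRow_of_gt (by omega), psum_succ p m,
      psum_succ q (m + 1), Nat.add_sub_cancel]
    omega

theorem reflectRow_reflectRow :
    reflectRow p (reflectRow p y q i d) q i (max (q (i + 1)) (p i) - 1 - y i) = y := by
  funext j
  rcases lt_trichotomy j i with hj | rfl | hj
  · rw [reflectRow_of_lt hj, reflectRow_of_lt hj]
  · rw [reflectRow_self]
    omega
  · rw [reflectRow_of_gt hj, reflectRow_of_gt hj]
    omega

end reflectRow

theorem flipAt_self : flipAt x i k (k + 1) =
    reflectRow (x k) (x (k + 1)) (x (k + 2)) i (latticeGap x k i) := by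
  simp [_root_.flipAt]

theorem flipAt_of_ne {k' : ℕ} (h : k' ≠ k + 1) : flipAt x i k k' = x k' := by
  simp [_root_.flipAt, h]

theorem psum_flipAt_of_le {k' m : ℕ} (hm : m ≤ i) :
    psum (flipAt x i k k') m = psum (x k') m := by
  by_cases h : k' = k + 1
  · subst h
    rw [flipAt_self, psum_reflectRow_of_le hm]
  · rw [flipAt_of_ne h]

theorem latticeGap_flipAt_of_lt {k' i' : ℕ} (h : i' < i) :
    latticeGap (flipAt x i k) k' i' = latticeGap x k' i' := by
  have h1 : i' ≤ i := h.le
  have h2 : i' + 1 ≤ i := h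
  simp only [latticeGap, psum_flipAt_of_le h1, psum_flipAt_of_le h2]

theorem latticeGap_flipAt_of_gt {k' : ℕ} (h : k < k') :
    latticeGap (flipAt x i k) k' i = latticeGap x k' i := by
  have h1 : k' + 1 ≠ k + 1 := by omega
  have h2 : k' + 2 ≠ k + 1 := by omega
  simp only [latticeGap, psum_flipAt_of_le le_rfl, flipAt_of_ne h1, flipAt_of_ne h2]

theorem latticeGap_flipAt_self :
    latticeGap (flipAt x i k) k i = max (x (k + 2) (i + 1)) (x k i) - 1 - x (k + 1) i := by
  have h2 : k + 2 ≠ k + 1 := by omega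
  have h := psum_reflectRow (p := x k) (y := x (k + 1)) (q := x (k + 2)) (i := i) rfl le_rfl
  unfold latticeGap
  rw [psum_flipAt_of_le le_rfl, psum_flipAt_of_le le_rfl, flipAt_self, flipAt_of_ne h2]
  unfold latticeGap
  linarith [psum_succ (x (k + 1)) i]

theorem flipAt_flipAt : flipAt (flipAt x i k) i k = x := by
  have h1 : k ≠ k + 1 := by omega
  have h2 : k + 2 ≠ k + 1 := by omega
  funext k'
  by_cases h : k' = k + 1
  · subst h
    rw [flipAt_self, latticeGap_flipAt_self, flipAt_self, flipAt_of_ne h1, flipAt_of_ne h2,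
      reflectRow_reflectRow]
  · rw [flipAt_of_ne h, flipAt_of_ne h]

theorem FirstFail.flipAt (h : FirstFail x i k) (h0 : Interl (x k) (x (k + 1)))
    (h1 : Interl (x (k + 1)) (x (k + 2))) : FirstFail (flipAt x i k) i k := by
  refine ⟨?_, fun i' hi' k' => ?_, fun k' hk' => ?_⟩
  · rw [latticeGap_flipAt_self]
    have := h0 i
    have := h1 i
    omega
  · rw [latticeGap_flipAt_of_lt hi']
    exact h.2.1 i' hi' k'
  · rw [latticeGap_flipAt_of_gt hk']
    exact h.2.2 k' hk'

theorem IsChainTo.row_lt (hx : IsChainTo r n lam x) (h : FirstFail x i k) : i < r := by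
  by_contra hi
  have hk := hx.lt_of_gap_neg h.1
  have := (h.gap_bounds (hx.interl k (by omega)) (hx.interl (k + 1) hk)).1
  rw [hx.eq_zero _ i (by omega), hx.eq_zero _ i (by omega)] at this
  have := h.1
  omega

theorem IsChainTo.flipAt (hx : IsChainTo r n lam x) (h : FirstFail x i k) :
    IsChainTo r n lam (flipAt x i k) := by
  have hk := hx.lt_of_gap_neg h.1
  have h0 := hx.interl k (by omega)
  have h1 := hx.interl (k + 1) hk
  obtain ⟨b1, b2⟩ := h.gap_bounds h0 h1
  obtain ⟨i1, i2⟩ := interl_reflectRow h0 h1 h.1 b1 b2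
  have hi := hx.row_lt h
  refine ⟨fun k' hk' => ?_, fun k' hk' => ?_, fun k' j => ?_, fun k' j hj => ?_⟩
  · rw [flipAt_of_ne (by omega)]
    exact hx.last k' hk'
  · by_cases e1 : k' = k
    · subst e1
      rw [flipAt_self, flipAt_of_ne (by omega)]
      exact i1
    · by_cases e2 : k' = k + 1
      · subst e2
        rw [flipAt_self, flipAt_of_ne (by omega)]
        exact i2
      · rw [flipAt_of_ne e2, flipAt_of_ne (by omega)]
        exact hx.interl k' hk'
  · by_cases e : k' = k + 1
    · subst e
      rw [flipAt_self]
      exact (hx.nonneg k j).trans (i1 j).1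
    · rw [flipAt_of_ne e]
      exact hx.nonneg k' j
  · by_cases e : k' = k + 1
    · subst e
      rw [flipAt_self]
      have a := (i1 j).1
      have b := (i2 j).1
      rw [hx.eq_zero k j hj] at a
      rw [hx.eq_zero (k + 2) j hj] at b
      exact le_antisymm b a
    · rw [flipAt_of_ne e]
      exact hx.eq_zero k' j hj

/-- The shifted content of a chain. -/
def shiftedContent (r : ℕ) (x : ℕ → ℕ → ℤ) (b : ℕ) : ℤ := psum (x (b + 1)) r - psum (x b) r - b

theorem IsChainTo.shiftedContent_flipAt (hx : IsChainTo r n lam x) (h : FirstFail x i k) (b : ℕ) :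
    shiftedContent r (_root_.flipAt x i k) b = shiftedContent r x (Equiv.swap k (k + 1) b) := by
  have hi := hx.row_lt h
  have hs : psum (_root_.flipAt x i k (k + 1)) r + psum (x (k + 1)) r =
      psum (x k) r + psum (x (k + 2)) r - 1 := by
    rw [flipAt_self]
    obtain ⟨m, rfl⟩ : ∃ m, r = m + 1 := ⟨r - 1, by omega⟩
    rw [psum_reflectRow (d := latticeGap x k i) (m := m) rfl (by omega), psum_succ (x k),
      hx.eq_zero (k + 2) (m + 1) le_rfl,
      max_eq_right (hx.nonneg k m)]
    ring
  unfold shiftedContent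
  by_cases e1 : b = k
  · subst e1
    rw [Equiv.swap_apply_left, flipAt_of_ne (k' := b) (by omega)]
    push_cast
    linarith
  · by_cases e2 : b = k + 1
    · subst e2
      rw [Equiv.swap_apply_right, flipAt_of_ne (k' := k + 1 + 1) (by omega)]
      push_cast
      linarith
    · rw [Equiv.swap_apply_of_ne_of_ne e1 e2, flipAt_of_ne (k' := b) (by omega),
        flipAt_of_ne (k' := b + 1) (by omega)]

end

/-! ### Pieri's rule for alternating polynomials -/

section

open MvPolynomial

theorem coeff_hsymm {σ R : Type*} [Fintype σ] [DecidableEq σ] [CommSemiring R] (m : ℕ)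
    (d : σ →₀ ℕ) : coeff d (hsymm σ R m) = if ∑ i, d i = m then 1 else 0 := by
  have hmon : ∀ s : Multiset σ,
      (s.map (X : σ → MvPolynomial σ R)).prod = monomial (Multiset.toFinsupp s) 1 := by
    intro s
    induction s using Multiset.induction_on with
    | empty => simp
    | cons a s ih =>
      rw [Multiset.map_cons, Multiset.prod_cons, ih, ← Multiset.singleton_add,
        Multiset.toFinsupp_add, Multiset.toFinsupp_singleton, X, monomial_mul, one_mul]
  have hcard : (Finsupp.toMultiset d).card = ∑ i, d i := by
    rw [Finsupp.card_toMultiset, Finsupp.sum_fintype _ _ (by simp)]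
    rfl
  simp only [hsymm, coeff_sum, hmon, coeff_monomial, Multiset.toFinsupp_eq_iff]
  split_ifs with h
  · refine (Finset.sum_eq_single (⟨Finsupp.toMultiset d, hcard.trans h⟩ : Sym σ m) ?_ ?_).trans
      (if_pos rfl)
    · exact fun s _ hs => if_neg fun h' => hs (Subtype.ext h')
    · exact fun h' => absurd (Finset.mem_univ (α := Sym σ m) _) h'
  · refine Finset.sum_eq_zero fun s _ => if_neg fun h' => h ?_
    rw [← hcard, ← h']
    exact s.2

/-- A polynomial is alternating if every transposition of the variables changes its sign. -/
def IsAlternating {r : ℕ} (f : MvPolynomial (Fin r) ℤ) : Prop :=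
  ∀ a b : Fin r, a ≠ b → rename (Equiv.swap a b) f = -f

variable {r : ℕ} {f : MvPolynomial (Fin r) ℤ}

theorem IsAlternating.coeff_mapDomain (hf : IsAlternating f) {a b : Fin r} (hab : a ≠ b)
    (d : Fin r →₀ ℕ) : coeff (d.mapDomain (Equiv.swap a b)) f = -coeff d f := by
  have h := coeff_rename_mapDomain _ (Equiv.swap a b).injective f d
  rw [hf a b hab, coeff_neg] at h
  rw [← h, neg_neg]

theorem IsAlternating.symm_mul {g : MvPolynomial (Fin r) ℤ} (hf : IsAlternating f)
    (hg : g.IsSymmetric) : IsAlternating (g * f) := by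
  intro a b hab
  rw [map_mul, hf a b hab, hg, mul_neg]

theorem isSymmetric_hkZ (m : ℤ) : (hkZ r m).IsSymmetric := by
  unfold hkZ
  split_ifs
  · exact hsymm_isSymmetric _ _ _
  · exact IsSymmetric.zero

theorem isAlternating_alternant (r : ℕ) : IsAlternating (alternant r) := by
  intro a b hab
  have h := Matrix.det_permute (Equiv.swap a b)
    (Matrix.of fun a b : Fin r => (X a : MvPolynomial (Fin r) ℤ) ^ (r - 1 - (b : ℕ)))
  rw [Equiv.Perm.sign_swap hab] at h
  rw [alternant, AlgHom.map_det]
  simp only [Units.val_neg, Units.val_one, Int.cast_neg, Int.cast_one, neg_mul, one_mul] at h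
  rw [← h]
  congr 1
  ext1 i j
  simp

/-- The coefficient of `x^(κ + (r - 1, …, 1, 0))`. -/
def partCoeff (r : ℕ) (f : MvPolynomial (Fin r) ℤ) (κ : ℕ → ℤ) : ℤ :=
  coeff (Finsupp.equivFunOnFinite.symm fun a : Fin r => (κ a).toNat + (r - 1 - (a : ℕ))) f

theorem coeff_hkZ_mul (m : ℤ) (e : Fin r →₀ ℕ) :
    coeff e (hkZ r m * f) =
      ∑ b ∈ (Finset.Iic e).filter (fun b => ((∑ i, b i : ℕ) : ℤ) + m = (∑ i, e i : ℕ)),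
        coeff b f := by
  rw [coeff_mul, Finset.sum_filter]
  refine Finset.sum_bij' (fun p _ => p.2) (fun b _ => (e - b, b)) ?_ ?_ ?_ ?_ ?_
  · intro p hp
    rw [Finset.HasAntidiagonal.mem_antidiagonal] at hp
    rw [Finset.mem_Iic, ← hp]
    exact le_add_self
  · intro b hb
    rw [Finset.HasAntidiagonal.mem_antidiagonal]
    exact tsub_add_cancel_of_le (Finset.mem_Iic.1 hb)
  · intro p hp
    rw [Finset.HasAntidiagonal.mem_antidiagonal] at hp
    ext1
    · simp [← hp]
    · rfl
  · intro b _
    rfl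
  · intro p hp
    rw [Finset.HasAntidiagonal.mem_antidiagonal] at hp
    have h : ∑ i, e i = ∑ i, p.1 i + ∑ i, p.2 i := by
      rw [← hp, ← Finset.sum_add_distrib]
      rfl
    unfold hkZ
    split_ifs with h1 h2 h2
    · rw [coeff_hsymm, if_pos (by omega), one_mul]
    · rw [coeff_hsymm, if_neg (by omega), zero_mul]
    · omega
    · simp

/-- Partitions `κ` such that `lam / κ` is a horizontal strip. -/
theorem finite_interl (r : ℕ) (lam : ℕ → ℤ) :
    {κ : ℕ → ℤ | Interl κ lam ∧ (∀ i, 0 ≤ κ i) ∧ ∀ i, r ≤ i → κ i = 0}.Finite := by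
  refine Set.Finite.of_injOn (f := fun (κ : ℕ → ℤ) (i : Fin r) => κ i)
    (t := Set.Icc 0 fun i => lam i) ?_ ?_ (Set.finite_Icc _ _)
  · intro κ hκ
    exact ⟨fun i => hκ.2.1 i, fun i => (hκ.1 i).1⟩
  · intro κ hκ κ' hκ' h
    funext i
    by_cases hi : i < r
    · exact congrFun h ⟨i, hi⟩
    · rw [hκ.2.2 i (by omega), hκ'.2.2 i (by omega)]

/-- The finite set of partitions `κ` such that `lam / κ` is a horizontal strip. -/
def interlFin (r : ℕ) (lam : ℕ → ℤ) : Finset (ℕ → ℤ) := (finite_interl r lam).toFinset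

theorem mem_interlFin {lam κ : ℕ → ℤ} :
    κ ∈ interlFin r lam ↔ Interl κ lam ∧ (∀ i, 0 ≤ κ i) ∧ ∀ i, r ≤ i → κ i = 0 := by
  simp [interlFin]

theorem Interl.isPart {lam κ : ℕ → ℤ} (h : κ ∈ interlFin r lam) : IsPart r κ := by
  rw [mem_interlFin] at h
  exact ⟨fun i => (h.1 (i + 1)).1.trans (h.1 i).2, h.2.1, h.2.2⟩

theorem psum_eq_sum_fin (p : ℕ → ℤ) : psum p r = ∑ i : Fin r, p i :=
  (Fin.sum_univ_eq_sum_range p r).symm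

/-- The index of the smallest row where the exponent `b` does not come from a partition
interlacing the one of the exponent `e`. -/
def FirstLow (e b : Fin r →₀ ℕ) (i j : Fin r) : Prop :=
  (j : ℕ) = i + 1 ∧ b i ≤ e j ∧ ∀ i' j' : Fin r, i' < i → (j' : ℕ) = i' + 1 → e j' < b i'

theorem FirstLow.unique {e b : Fin r →₀ ℕ} {i j i' j' : Fin r} (h : FirstLow e b i j)
    (h' : FirstLow e b i' j') : i = i' ∧ j = j' := by
  have hi : i = i' := by
    rcases lt_trichotomy i i' with hlt | heq | hlt
    · exact absurd h.2.1 (not_le.2 (h'.2.2 _ _ hlt h.1))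
    · exact heq
    · exact absurd h'.2.1 (not_le.2 (h.2.2 _ _ hlt h'.1))
  subst hi
  exact ⟨rfl, Fin.ext (h.1.trans h'.1.symm)⟩

theorem exists_firstLow {e b : Fin r →₀ ℕ} (h : ∃ i j : Fin r, (j : ℕ) = i + 1 ∧ b i ≤ e j) :
    ∃ i j, FirstLow e b i j := by
  classical
  let s : Finset (Fin r) := Finset.univ.filter fun i => ∃ j : Fin r, (j : ℕ) = i + 1 ∧ b i ≤ e j
  have hs : s.Nonempty := by
    obtain ⟨i, j, h⟩ := h
    exact ⟨i, by simpa [s] using ⟨j, h⟩⟩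
  obtain ⟨j, hj1, hj2⟩ := (Finset.mem_filter.1 (s.min'_mem hs)).2
  refine ⟨s.min' hs, j, hj1, hj2, fun i' j' hi' hj' => ?_⟩
  by_contra hc
  exact absurd (s.min'_le i' (Finset.mem_filter.2 ⟨Finset.mem_univ _, j', hj', not_lt.1 hc⟩))
    (not_le.2 hi')

theorem FirstLow.mapDomain {e b : Fin r →₀ ℕ} {i j : Fin r} (h : FirstLow e b i j)
    (hb : b ≤ e) : FirstLow e (b.mapDomain (Equiv.swap i j)) i j := by
  refine ⟨h.1, ?_, fun i' j' hi' hj' => ?_⟩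
  · rw [Finsupp.mapDomain_equiv_apply, Equiv.symm_swap, Equiv.swap_apply_left]
    exact hb j
  · rw [Finsupp.mapDomain_equiv_apply, Equiv.symm_swap, Equiv.swap_apply_of_ne_of_ne]
    · exact h.2.2 i' j' hi' hj'
    · exact hi'.ne
    · rintro rfl
      have := h.1
      exact absurd hi' (by simp [Fin.lt_def, this])

theorem IsAlternating.sum_low (hf : IsAlternating f) {e : Fin r →₀ ℕ} (m : ℤ)
    (he : ∀ i j : Fin r, (j : ℕ) = i + 1 → e j < e i) :
    ∑ b ∈ ((Finset.Iic e).filter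
        (fun b => ((∑ i, b i : ℕ) : ℤ) + m = (∑ i, e i : ℕ))).filter
        (fun b => ∃ i j : Fin r, (j : ℕ) = i + 1 ∧ b i ≤ e j), coeff b f = 0 := by
  choose i j hij using fun (b : Fin r →₀ ℕ)
    (h : ∃ i j : Fin r, (j : ℕ) = i + 1 ∧ b i ≤ e j) => exists_firstLow h
  have hne : ∀ b h, i b h ≠ j b h := fun b h heq => by
    have := (hij b h).1
    rw [heq] at this
    omega
  have hmem : ∀ b (hb : b ≤ e) h, b.mapDomain (Equiv.swap (i b h) (j b h)) ≤ e := by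
    intro b hb h a
    have h1 := (hij b h).2.1
    have h2 := he _ _ (hij b h).1
    rw [Finsupp.mapDomain_equiv_apply, Equiv.symm_swap]
    rcases eq_or_ne a (i b h) with rfl | ha
    · rw [Equiv.swap_apply_left]
      exact (hb _).trans h2.le
    · rcases eq_or_ne a (j b h) with rfl | ha'
      · rwa [Equiv.swap_apply_right]
      · rw [Equiv.swap_apply_of_ne_of_ne ha ha']
        exact hb a
  refine Finset.sum_involution
    (fun b hb => b.mapDomain (Equiv.swap (i b (Finset.mem_filter.1 hb).2)
      (j b (Finset.mem_filter.1 hb).2))) ?_ ?_ ?_ ?_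
  · intro b hb
    rw [hf.coeff_mapDomain (hne _ _), add_neg_cancel]
  · intro b hb h0 heq
    have := hf.coeff_mapDomain (hne b (Finset.mem_filter.1 hb).2) b
    rw [heq] at this
    omega
  · intro b hb
    obtain ⟨hb1, hb2⟩ := Finset.mem_filter.1 hb
    obtain ⟨hb3, hb4⟩ := Finset.mem_filter.1 hb1
    have hbe := Finset.mem_Iic.1 hb3
    refine Finset.mem_filter.2 ⟨Finset.mem_filter.2 ⟨Finset.mem_Iic.2 (hmem b hbe hb2), ?_⟩, ?_⟩
    · refine Eq.trans ?_ hb4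
      simp only [Finsupp.mapDomain_equiv_apply]
      rw [Equiv.sum_comp _ fun a => b a]
    · have := (hij b hb2).mapDomain hbe
      exact ⟨_, _, this.1, this.2.1⟩
  · intro b hb
    obtain ⟨hb1, hb2⟩ := Finset.mem_filter.1 hb
    have hbe := Finset.mem_Iic.1 (Finset.mem_filter.1 hb1).1
    have h1 := (hij b hb2).mapDomain hbe
    obtain ⟨e1, e2⟩ := (hij _ ⟨_, _, h1.1, h1.2.1⟩).unique h1
    rw [e1, e2, ← Finsupp.mapDomain_comp]
    convert Finsupp.mapDomain_id
    ext a
    simp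

/-- Pieri's rule. -/
theorem IsAlternating.partCoeff_hkZ_mul (hf : IsAlternating f) (m : ℤ) {lam : ℕ → ℤ}
    (hlam : IsPart r lam) :
    partCoeff r (hkZ r m * f) lam =
      ∑ κ ∈ (interlFin r lam).filter (fun κ => psum κ r + m = psum lam r), partCoeff r f κ := by
  have hanti := hlam.anti
  have hnonneg := hlam.nonneg
  unfold partCoeff
  rw [coeff_hkZ_mul, ← Finset.sum_filter_add_sum_filter_not _
    (fun b => ∃ i j : Fin r, (j : ℕ) = i + 1 ∧ b i ≤
      (Finsupp.equivFunOnFinite.symm fun a : Fin r => (lam a).toNat + (r - 1 - (a : ℕ))) j),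
    hf.sum_low, zero_add]
  · set e : Fin r →₀ ℕ := Finsupp.equivFunOnFinite.symm fun a : Fin r =>
      (lam a).toNat + (r - 1 - (a : ℕ)) with he
    have hea : ∀ a : Fin r, e a = (lam a).toNat + (r - 1 - (a : ℕ)) := fun a => rfl
    have hsum : ∀ (b : Fin r →₀ ℕ) (κ : ℕ → ℤ), (∀ a : Fin r, κ a = b a - (r - 1 - a : ℕ)) →
        (((∑ i, b i : ℕ) : ℤ) + m = (∑ i, e i : ℕ) ↔ psum κ r + m = psum lam r) := by
      intro b κ h
      have h1 : ((∑ i, b i : ℕ) : ℤ) = psum κ r + ∑ i : Fin r, ((r - 1 - i : ℕ) : ℤ) := by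
        rw [psum_eq_sum_fin, ← Finset.sum_add_distrib]
        push_cast
        exact Finset.sum_congr rfl fun a _ => by rw [h a]; ring
      have h2 : ((∑ i, e i : ℕ) : ℤ) = psum lam r + ∑ i : Fin r, ((r - 1 - i : ℕ) : ℤ) := by
        rw [psum_eq_sum_fin, ← Finset.sum_add_distrib, Nat.cast_sum]
        refine Finset.sum_congr rfl fun a _ => ?_
        have := hnonneg a
        rw [hea]
        omega
      rw [h1, h2]
      constructor <;> intro h <;> linarith
    have hmem : ∀ b ∈ ((Finset.Iic e).filter
        (fun b => ((∑ i, b i : ℕ) : ℤ) + m = (∑ i, e i : ℕ))).filter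
        (fun b => ¬ ∃ i j : Fin r, (j : ℕ) = i + 1 ∧ b i ≤ e j),
        ∀ i (hi : i < r), lam (i + 1) ≤ (b ⟨i, hi⟩ : ℤ) - (r - 1 - i : ℕ) ∧
          (b ⟨i, hi⟩ : ℤ) - (r - 1 - i : ℕ) ≤ lam i := by
      intro b hb i hi
      obtain ⟨hb1, hb2⟩ := Finset.mem_filter.1 hb
      have hbe := Finset.mem_Iic.1 (Finset.mem_filter.1 hb1).1 ⟨i, hi⟩
      rw [hea] at hbe
      have h0 := hnonneg i
      have h1 := hnonneg (i + 1)
      simp only at hbe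
      refine ⟨?_, by omega⟩
      by_cases hi' : i + 1 < r
      · have : e ⟨i + 1, hi'⟩ < b ⟨i, hi⟩ := by
          by_contra hc
          exact hb2 ⟨⟨i, hi⟩, ⟨i + 1, hi'⟩, rfl, not_lt.1 hc⟩
        rw [hea] at this
        simp only at this
        omega
      · rw [hlam.eq_zero (i + 1) (by omega)]
        omega
    refine Finset.sum_bij'
      (fun b _ i => if h : i < r then (b ⟨i, h⟩ : ℤ) - (r - 1 - i : ℕ) else 0)
      (fun κ _ => Finsupp.equivFunOnFinite.symm fun a : Fin r =>
        (κ a).toNat + (r - 1 - (a : ℕ))) ?_ ?_ ?_ ?_ ?_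
    · intro b hb
      have h := hmem b hb
      refine Finset.mem_filter.2 ⟨mem_interlFin.2 ⟨fun i => ?_, fun i => ?_, fun i hi => ?_⟩, ?_⟩
      · by_cases hi : i < r
        · simpa [hi] using (h i hi).symm
        · simp [hi, hlam.eq_zero i (by omega), hlam.eq_zero (i + 1) (by omega)]
      · by_cases hi : i < r
        · simpa [hi] using (hnonneg (i + 1)).trans (h i hi).1
        · simp [hi]
      · simp [not_lt.2 hi]
      · exact (hsum b _ fun a => by simp).1
          (Finset.mem_filter.1 (Finset.mem_filter.1 hb).1).2
    · intro κ hκ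
      obtain ⟨hκ1, hκ2⟩ := Finset.mem_filter.1 hκ
      obtain ⟨hκ3, hκ4, hκ5⟩ := mem_interlFin.1 hκ1
      refine Finset.mem_filter.2 ⟨Finset.mem_filter.2 ⟨Finset.mem_Iic.2 fun a => ?_, ?_⟩, ?_⟩
      · have := (hκ3 a).1
        rw [hea]
        simp only [Finsupp.coe_equivFunOnFinite_symm]
        omega
      · refine (hsum _ κ fun a => ?_).2 hκ2
        have := hκ4 a
        simp only [Finsupp.coe_equivFunOnFinite_symm]
        omega
      · rintro ⟨i, j, hij, h⟩
        have := (hκ3 i).2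
        have := hnonneg (i + 1)
        have := j.2
        rw [hea] at h
        simp only [Finsupp.coe_equivFunOnFinite_symm, hij] at h
        omega
    · intro b hb
      ext a
      have h := (hmem b hb a a.2).1
      have := hnonneg (a + 1)
      simp only [Finsupp.coe_equivFunOnFinite_symm, a.2, dite_true, Fin.eta] at h ⊢
      omega
    · intro κ hκ
      obtain ⟨hκ3, hκ4, hκ5⟩ := mem_interlFin.1 (Finset.mem_filter.1 hκ).1
      funext i
      have := hκ4 i
      by_cases hi : i < r
      · simp only [hi, dite_true, Finsupp.coe_equivFunOnFinite_symm]
        omega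
      · simp [hi, hκ5 i (by omega)]
    · intro b hb
      congr 1
      ext a
      have h := (hmem b hb a a.2).1
      have := hnonneg (a + 1)
      simp only [Finsupp.coe_equivFunOnFinite_symm, a.2, dite_true, Fin.eta] at h ⊢
      omega
  · intro i j hij
    have := hanti i
    have := hnonneg i
    have := j.2
    simp only [Finsupp.coe_equivFunOnFinite_symm, hij]
    omega

end

/-! ### The Littlewood–Richardson rule -/

section

open MvPolynomial

variable {r n : ℕ} {lam : ℕ → ℤ} {x : ℕ → ℕ → ℤ} {f : MvPolynomial (Fin r) ℤ}

theorem IsChainTo.isPart (hx : IsChainTo r n lam x) (hlam : IsPart r lam) (k : ℕ) :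
    IsPart r (x k) := by
  by_cases hk : k < n
  · exact ⟨fun i => ((hx.interl k hk) (i + 1)).1.trans ((hx.interl k hk) i).2, hx.nonneg k,
      hx.eq_zero k⟩
  · rwa [hx.last k (not_lt.1 hk)]

theorem IsChainTo.le_succ (hx : IsChainTo r n lam x) (k i : ℕ) : x k i ≤ x (k + 1) i := by
  by_cases hk : k < n
  · exact (hx.interl k hk i).1
  · rw [hx.last k (not_lt.1 hk), hx.last (k + 1) (by omega)]

theorem IsChainTo.le_last (hx : IsChainTo r n lam x) (k i : ℕ) : x k i ≤ lam i := by
  have hm : Monotone fun k => x k i := monotone_nat_of_le_succ fun k => hx.le_succ k i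
  have := hm (le_max_left k n)
  simp only [hx.last _ (le_max_right k n)] at this
  exact this

theorem finite_chains (r n : ℕ) (lam : ℕ → ℤ) : {x | IsChainTo r n lam x}.Finite := by
  refine Set.Finite.of_injOn (f := fun (x : ℕ → ℕ → ℤ) (p : Fin n × Fin r) => x p.1 p.2)
    (t := Set.Icc 0 fun p => lam p.2) ?_ ?_ (Set.finite_Icc _ _)
  · intro x hx
    exact ⟨fun p => hx.nonneg _ _, fun p => hx.le_last _ _⟩
  · intro x hx y hy h
    funext k i
    by_cases hk : k < n
    · by_cases hi : i < r
      · exact congrFun h (⟨k, hk⟩, ⟨i, hi⟩)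
      · rw [hx.eq_zero k i (by omega), hy.eq_zero k i (by omega)]
    · rw [hx.last k (by omega), hy.last k (by omega)]

/-- The finite set of chains of `n` horizontal strips ending in `lam`. -/
def chainFin (r n : ℕ) (lam : ℕ → ℤ) : Finset (ℕ → ℕ → ℤ) := (finite_chains r n lam).toFinset

theorem mem_chainFin : x ∈ chainFin r n lam ↔ IsChainTo r n lam x := by
  simp [chainFin]

theorem chainFin_zero (hlam : IsPart r lam) : chainFin r 0 lam = {fun _ => lam} := by
  ext x
  rw [mem_chainFin, Finset.mem_singleton]
  refine ⟨fun hx => funext fun k => hx.last k (Nat.zero_le k), ?_⟩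
  rintro rfl
  exact ⟨fun _ _ => rfl, fun k hk => absurd hk (Nat.not_lt_zero k), fun _ => hlam.nonneg,
    fun _ => hlam.eq_zero⟩

theorem sum_chainFin_succ (hlam : IsPart r lam) (F : (ℕ → ℕ → ℤ) → ℤ) :
    ∑ x ∈ chainFin r (n + 1) lam, F x = ∑ κ ∈ interlFin r lam, ∑ y ∈ chainFin r n κ,
      F fun k => if k ≤ n then y k else lam := by
  rw [Finset.sum_sigma']
  refine Finset.sum_bij' (fun x _ => ⟨x n, fun k => if k ≤ n then x k else x n⟩)
    (fun p _ k => if k ≤ n then p.2 k else lam) ?_ ?_ ?_ ?_ ?_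
  · intro x hx
    rw [mem_chainFin] at hx
    refine Finset.mem_sigma.2 ⟨mem_interlFin.2 ⟨?_, hx.nonneg n, hx.eq_zero n⟩,
      mem_chainFin.2 ⟨fun k hk => ?_, fun k hk => ?_, fun k i => ?_, fun k i hi => ?_⟩⟩
    · have := hx.interl n (by omega)
      rwa [hx.last (n + 1) le_rfl] at this
    · rcases hk.eq_or_lt with rfl | hk
      · simp
      · simp [not_le.2 hk]
    · simp only [hk.le, Nat.succ_le_of_lt hk, if_true]
      exact hx.interl k (by omega)
    · simp only
      split_ifs
      exacts [hx.nonneg _ _, hx.nonneg _ _]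
    · simp only
      split_ifs
      exacts [hx.eq_zero _ _ hi, hx.eq_zero _ _ hi]
  · rintro ⟨κ, y⟩ hp
    obtain ⟨hκ, hy⟩ := Finset.mem_sigma.1 hp
    rw [mem_chainFin] at hy
    rw [mem_interlFin] at hκ
    refine mem_chainFin.2 ⟨fun k hk => ?_, fun k hk => ?_, fun k i => ?_, fun k i hi => ?_⟩
    · simp [show ¬ k ≤ n by omega]
    · rcases (Nat.lt_succ_iff.1 hk).eq_or_lt with rfl | hk'
      · have : y k = κ := hy.last k le_rfl
        simpa [this] using hκ.1
      · simp only [hk'.le, Nat.succ_le_of_lt hk', if_true]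
        exact hy.interl k hk'
    · simp only
      split_ifs
      exacts [hy.nonneg _ _, hlam.nonneg _]
    · simp only
      split_ifs
      exacts [hy.eq_zero _ _ hi, hlam.eq_zero _ hi]
  · intro x hx
    rw [mem_chainFin] at hx
    funext k
    simp only
    split_ifs with hk
    · rfl
    · exact (hx.last k (by omega)).symm
  · rintro ⟨κ, y⟩ hp
    obtain ⟨hκ, hy⟩ := Finset.mem_sigma.1 hp
    rw [mem_chainFin] at hy
    have h1 : y n = κ := hy.last n le_rfl
    have h2 : (fun k => if k ≤ n then y k else κ) = y := by
      funext k
      split_ifs with hk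
      · rfl
      · exact (hy.last k (by omega)).symm
    simp only [le_rfl, if_true, h1]
    congr 1
    refine Eq.trans ?_ h2
    funext k
    split_ifs <;> rfl
  · intro x hx
    rw [mem_chainFin] at hx
    congr 1
    funext k
    simp only
    split_ifs with hk
    · rfl
    · exact hx.last k (by omega)

theorem isSymmetric_prod_hkZ (α : ℕ → ℤ) (n : ℕ) :
    (∏ b ∈ Finset.range n, hkZ r (α b)).IsSymmetric := by
  induction n with
  | zero => simp [IsSymmetric.one]
  | succ n ih =>
    rw [Finset.prod_range_succ]
    exact ih.mul (isSymmetric_hkZ _)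

theorem IsAlternating.partCoeff_prod_hkZ_mul (hf : IsAlternating f) (α : ℕ → ℤ)
    (hlam : IsPart r lam) :
    partCoeff r ((∏ b ∈ Finset.range n, hkZ r (α b)) * f) lam =
      ∑ x ∈ chainFin r n lam,
        if ∀ b < n, psum (x b) r + α b = psum (x (b + 1)) r then partCoeff r f (x 0) else 0 := by
  induction n generalizing lam with
  | zero => simp [chainFin_zero hlam]
  | succ n ih =>
    rw [Finset.prod_range_succ, mul_comm (∏ b ∈ Finset.range n, hkZ r (α b)), mul_assoc,
      (hf.symm_mul (isSymmetric_prod_hkZ α n)).partCoeff_hkZ_mul _ hlam,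
      sum_chainFin_succ hlam, Finset.sum_filter]
    refine Finset.sum_congr rfl fun κ hκ => ?_
    rw [ih (Interl.isPart hκ)]
    split_ifs with h
    · refine Finset.sum_congr rfl fun y hy => ?_
      rw [mem_chainFin] at hy
      refine if_congr ⟨fun h' b hb => ?_, fun h' b hb => ?_⟩ rfl rfl
      · rcases (Nat.lt_succ_iff.1 hb).eq_or_lt with rfl | hb'
        · simpa [hy.last b le_rfl] using h
        · simpa [hb'.le, Nat.succ_le_of_lt hb'] using h' b hb'
      · simpa [hb.le, Nat.succ_le_of_lt hb] using h' b (by omega)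
    · symm
      refine Finset.sum_eq_zero fun y hy => if_neg fun h' => h ?_
      rw [mem_chainFin] at hy
      simpa [hy.last n le_rfl] using h' n (by omega)

/-- The signed number of permutations carrying `v` to `β`. -/
def permSign (v β : Fin r → ℤ) : ℤ :=
  ∑ σ : Equiv.Perm (Fin r), if ∀ b, β b = v (σ b) then (Equiv.Perm.sign σ : ℤ) else 0

theorem permSign_swap (v β : Fin r → ℤ) {a b : Fin r} (hab : a ≠ b) :
    permSign v (fun c => β (Equiv.swap a b c)) = -permSign v β := by
  unfold permSign
  rw [← Finset.sum_neg_distrib]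
  refine Fintype.sum_equiv (Equiv.mulRight (Equiv.swap a b)) _ _ fun σ => ?_
  simp only [Equiv.coe_mulRight, Equiv.Perm.sign_mul, Equiv.Perm.sign_swap hab]
  have h : (∀ c, β (Equiv.swap a b c) = v (σ c)) ↔ ∀ c, β c = v ((σ * Equiv.swap a b) c) :=
    ⟨fun h c => by simpa using h (Equiv.swap a b c), fun h c => by simpa using h (Equiv.swap a b c)⟩
  rw [if_congr h rfl rfl]
  split_ifs <;> simp

theorem permSign_of_strictAnti {v β : Fin r → ℤ} (hv : StrictAnti v) (hβ : StrictAnti β) :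
    permSign v β = if β = v then 1 else 0 := by
  have key : ∀ σ : Equiv.Perm (Fin r), (∀ b, β b = v (σ b)) ↔ β = v ∧ σ = 1 := by
    intro σ
    refine ⟨fun h => ?_, ?_⟩
    · have h1 : β = v := by
        refine Set.range_injOn_strictAnti hβ hv ?_
        have : β = v ∘ σ := funext h
        rw [this, σ.surjective.range_comp]
      refine ⟨h1, Equiv.ext fun b => hv.injective ?_⟩
      rw [← h b, h1]
      rfl
    · rintro ⟨rfl, rfl⟩ b
      rfl
  unfold permSign
  simp only [key]
  split_ifs with h <;> simp [h]

/-- The exponents `mu a - a`. -/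
def shiftedPart (mu : Fin r → ℕ) (a : Fin r) : ℤ := mu a - (a : ℕ)

theorem strictAnti_shiftedPart {mu : Fin r → ℕ} (hmu : Antitone mu) :
    StrictAnti (shiftedPart mu) := by
  intro a b hab
  have := hmu hab.le
  have : (a : ℕ) < b := hab
  unfold shiftedPart
  omega

theorem isSymmetric_schurP (mu : Fin r → ℕ) : (schurP mu).IsSymmetric := by
  intro e
  rw [schurP, AlgHom.map_det]
  congr 1
  ext1 i j
  exact isSymmetric_hkZ _ e

theorem IsAlternating.partCoeff_schurP_mul (hf : IsAlternating f) (mu : Fin r → ℕ)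
    (hlam : IsPart r lam) :
    partCoeff r (schurP mu * f) lam = ∑ x ∈ chainFin r r lam,
      permSign (shiftedPart mu) (fun b => shiftedContent r x b) * partCoeff r f (x 0) := by
  have hterm : ∀ σ : Equiv.Perm (Fin r),
      partCoeff r ((∏ b, hkZ r (mu (σ b) - (σ b : ℕ) + (b : ℕ))) * f) lam =
        ∑ x ∈ chainFin r r lam, if ∀ b : Fin r, shiftedContent r x b = shiftedPart mu (σ b)
          then partCoeff r f (x 0) else 0 := by
    intro σ
    have := hf.partCoeff_prod_hkZ_mul (n := r)
      (fun b => if h : b < r then shiftedPart mu (σ ⟨b, h⟩) + b else 0) hlam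
    rw [← Fin.prod_univ_eq_prod_range] at this
    simp only [Fin.is_lt, dite_true, Fin.eta] at this
    refine Eq.trans this (Finset.sum_congr rfl fun x _ => if_congr ?_ rfl rfl)
    unfold shiftedContent
    refine ⟨fun h b => ?_, fun h b hb => ?_⟩
    · have := h b b.2
      simp only [Fin.is_lt, dite_true, Fin.eta] at this
      linarith
    · have := h ⟨b, hb⟩
      simp only [hb, dite_true] at this ⊢
      linarith
  have hexp : partCoeff r (schurP mu * f) lam = ∑ σ : Equiv.Perm (Fin r),
      (Equiv.Perm.sign σ : ℤ) *
        partCoeff r ((∏ b, hkZ r (mu (σ b) - (σ b : ℕ) + (b : ℕ))) * f) lam := by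
    unfold partCoeff schurP
    rw [Matrix.det_apply, Finset.sum_mul, coeff_sum]
    refine Finset.sum_congr rfl fun σ _ => ?_
    rw [smul_mul_assoc, Units.smul_def, coeff_smul, smul_eq_mul]
    rfl
  rw [hexp]
  simp only [hterm, Finset.mul_sum, permSign, Finset.sum_mul]
  rw [Finset.sum_comm]
  refine Finset.sum_congr rfl fun x _ => Finset.sum_congr rfl fun σ _ => ?_
  split_ifs <;> simp

end

section

open MvPolynomial

variable {r n : ℕ} {lam : ℕ → ℤ} {x : ℕ → ℕ → ℤ} {f : MvPolynomial (Fin r) ℤ}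

/-- The lattice condition of the Littlewood–Richardson rule. -/
def IsLatticeChain (x : ℕ → ℕ → ℤ) : Prop := ∀ k i, 0 ≤ latticeGap x k i

theorem IsChainTo.permSign_flipAt (hx : IsChainTo r r lam x) {i k : ℕ} (h : FirstFail x i k)
    (v : Fin r → ℤ) :
    permSign v (fun b => shiftedContent r (_root_.flipAt x i k) b) =
      -permSign v (fun b => shiftedContent r x b) := by
  have hk := hx.lt_of_gap_neg h.1
  rw [← permSign_swap v _ (a := ⟨k, by omega⟩) (b := ⟨k + 1, hk⟩) (by simp)]
  congr 1
  funext b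
  rw [hx.shiftedContent_flipAt h, ← Fin.val_injective.swap_apply]

open Classical in
theorem sum_not_isLattice (v : Fin r → ℤ) (F : (ℕ → ℤ) → ℤ) :
    ∑ x ∈ (chainFin r r lam).filter (fun x => ∃ k i, latticeGap x k i < 0),
      permSign v (fun b => shiftedContent r x b) * F (x 0) = 0 := by
  have hbad : ∀ x ∈ (chainFin r r lam).filter (fun x => ∃ k i, latticeGap x k i < 0),
      ∃ i k, FirstFail x i k := fun x hx =>
    (mem_chainFin.1 (Finset.mem_filter.1 hx).1).exists_firstFail (Finset.mem_filter.1 hx).2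
  have hmem : ∀ x ∈ (chainFin r r lam).filter (fun x => ∃ k i, latticeGap x k i < 0),
      IsChainTo r r lam x := fun x hx => mem_chainFin.1 (Finset.mem_filter.1 hx).1
  choose i k hik using hbad
  have hfail : ∀ x hx, FirstFail (flipAt x (i x hx) (k x hx)) (i x hx) (k x hx) := by
    intro x hx
    have hk := (hmem x hx).lt_of_gap_neg (hik x hx).1
    exact (hik x hx).flipAt ((hmem x hx).interl _ (by omega)) ((hmem x hx).interl _ hk)
  refine Finset.sum_involution (fun x hx => flipAt x (i x hx) (k x hx)) ?_ ?_ ?_ ?_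
  · intro x hx
    rw [(hmem x hx).permSign_flipAt (hik x hx), flipAt_of_ne (by omega)]
    ring
  · intro x hx h0 heq
    have := (hmem x hx).permSign_flipAt (hik x hx) v
    rw [heq] at this
    exact h0 (by rw [show permSign v (fun b => shiftedContent r x b) = 0 by omega, zero_mul])
  · intro x hx
    exact Finset.mem_filter.2 ⟨mem_chainFin.2 ((hmem x hx).flipAt (hik x hx)), _, _, (hfail x hx).1⟩
  · intro x hx
    have hx' : flipAt x (i x hx) (k x hx) ∈
        (chainFin r r lam).filter (fun x => ∃ k i, latticeGap x k i < 0) :=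
      Finset.mem_filter.2 ⟨mem_chainFin.2 ((hmem x hx).flipAt (hik x hx)), _, _, (hfail x hx).1⟩
    obtain ⟨e1, e2⟩ := (hik _ hx').unique (hfail x hx)
    rw [e1, e2, flipAt_flipAt]

theorem IsChainTo.strictAnti_shiftedContent (hx : IsChainTo r n lam x) (hl : IsLatticeChain x) :
    StrictAnti (shiftedContent r x) := by
  refine strictAnti_nat_of_succ_lt fun k => ?_
  have h := hl k r
  unfold latticeGap at h
  rw [psum_succ, psum_succ, hx.eq_zero _ r le_rfl, hx.eq_zero _ r le_rfl] at h
  unfold shiftedContent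
  push_cast
  rw [show k + 1 + 1 = k + 2 from rfl]
  linarith

/-- The content of the chain `x` is `mu`. -/
def HasContent (r : ℕ) (mu : Fin r → ℕ) (x : ℕ → ℕ → ℤ) : Prop :=
  ∀ b : Fin r, psum (x (b + 1)) r - psum (x b) r = mu b

open Classical in
theorem IsAlternating.partCoeff_schurP_mul_eq_sum (hf : IsAlternating f) {mu : Fin r → ℕ}
    (hmu : Antitone mu) (hlam : IsPart r lam) :
    partCoeff r (schurP mu * f) lam =
      ∑ x ∈ (chainFin r r lam).filter (fun x => IsLatticeChain x ∧ HasContent r mu x),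
        partCoeff r f (x 0) := by
  have h := sum_not_isLattice (lam := lam) (shiftedPart mu) (partCoeff r f)
  rw [hf.partCoeff_schurP_mul mu hlam, ← Finset.sum_filter_add_sum_filter_not _
    (fun x => ∃ k i, latticeGap x k i < 0), h, zero_add, Finset.sum_filter, Finset.sum_filter]
  refine Finset.sum_congr rfl fun x hx => ?_
  rw [mem_chainFin] at hx
  have hiff : (¬ ∃ k i, latticeGap x k i < 0) ↔ IsLatticeChain x := by
    simp [IsLatticeChain]
  rw [if_congr hiff rfl rfl]
  by_cases hl : IsLatticeChain x
  · rw [if_pos hl, permSign_of_strictAnti (strictAnti_shiftedPart hmu)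
      fun a b hab => hx.strictAnti_shiftedContent hl hab]
    have : (fun b : Fin r => shiftedContent r x b) = shiftedPart mu ↔ HasContent r mu x := by
      rw [_root_.funext_iff]
      refine forall_congr' fun b => ?_
      unfold shiftedContent shiftedPart
      constructor <;> intro h <;> linarith
    by_cases hc : HasContent r mu x
    · rw [if_pos (this.2 hc), one_mul, if_pos ⟨hl, hc⟩]
    · rw [if_neg (this.not.2 hc), zero_mul, if_neg fun h => hc h.2]
  · rw [if_neg hl, if_neg fun h => hl h.1]

open Classical in
theorem partCoeff_alternant {κ : ℕ → ℤ} (hκ : IsPart r κ) :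
    partCoeff r (alternant r) κ = if ∀ i, κ i = 0 then 1 else 0 := by
  have hanti : Antitone κ := antitone_nat_of_succ_le hκ.anti
  have h : partCoeff r (alternant r) κ =
      permSign (fun a : Fin r => κ a - (a : ℕ)) (fun b => -(b : ℕ)) := by
    unfold partCoeff alternant permSign
    rw [Matrix.det_apply, coeff_sum]
    refine Finset.sum_congr rfl fun σ _ => ?_
    have hprod : ∏ b : Fin r, (X (σ b) : MvPolynomial (Fin r) ℤ) ^ (r - 1 - (b : ℕ)) =
        monomial (Finsupp.equivFunOnFinite.symm fun a => r - 1 - (σ.symm a : ℕ)) 1 := by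
      rw [← Equiv.prod_comp σ.symm, monomial_eq, Finsupp.prod_fintype _ _ (by simp)]
      simp
    simp only [Matrix.of_apply]
    rw [hprod, Units.smul_def, coeff_smul, coeff_monomial, smul_eq_mul, mul_ite, mul_one, mul_zero]
    refine if_congr ?_ rfl rfl
    rw [Equiv.apply_eq_iff_eq, _root_.funext_iff, ← σ.forall_congr_right]
    refine forall_congr' fun b => ?_
    have := hκ.nonneg (σ b)
    have := (σ b).2
    rw [Equiv.symm_apply_apply]
    omega
  rw [h, permSign_of_strictAnti]
  · refine if_congr ⟨fun h i => ?_, fun h => ?_⟩ rfl rfl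
    · by_cases hi : i < r
      · have := congrFun h ⟨i, hi⟩
        simp only at this
        linarith
      · exact hκ.eq_zero i (not_lt.1 hi)
    · funext b
      simp [h]
  · intro a b hab
    have h1 := hanti (show (a : ℕ) ≤ b from hab.le)
    have h2 : (a : ℕ) < b := hab
    simp only
    omega
  · intro a b hab
    have h2 : (a : ℕ) < b := hab
    simp only
    omega

/-- In a Littlewood–Richardson tableau the letter `k` does not occur in the rows before `k`. -/
theorem IsChainTo.succ_eq_of_lt (hx : IsChainTo r n lam x) (hl : IsLatticeChain x) {k i : ℕ}
    (hi : i < k) : x (k + 1) i = x k i := by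
  induction k generalizing i with
  | zero => omega
  | succ k ih =>
    have h1 : psum (x (k + 1)) i = psum (x k) i := psum_congr fun j hj => ih (by omega)
    have h2 := hl k i
    unfold latticeGap at h2
    rw [h1, psum_succ, psum_succ] at h2
    have h3 : psum (x (k + 1)) i ≤ psum (x (k + 2)) i :=
      psum_le fun j => hx.le_succ (k + 1) j
    have h4 := hx.le_succ (k + 1) i
    rw [show k + 1 + 1 = k + 2 from rfl] at *
    omega

theorem IsChainTo.eq_last (hx : IsChainTo r n lam x) (hl : IsLatticeChain x) {k i : ℕ}
    (hi : i < k) : x k i = lam i := by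
  have h : ∀ m, x (k + m) i = x k i := by
    intro m
    induction m with
    | zero => rfl
    | succ m ih => rw [← ih, ← add_assoc, hx.succ_eq_of_lt hl (by omega)]
  rw [← h n, hx.last _ (by omega)]

/-- Extension of a tuple of natural numbers by zero. -/
def extZero (mu : Fin r → ℕ) (i : ℕ) : ℤ := if h : i < r then mu ⟨i, h⟩ else 0

theorem extZero_val (mu : Fin r → ℕ) (a : Fin r) : extZero mu a = mu a := by
  simp [extZero]

theorem isPart_extZero {mu : Fin r → ℕ} (hmu : Antitone mu) : IsPart r (extZero mu) := by
  have hn : ∀ i, 0 ≤ extZero mu i := fun i => by unfold extZero; split_ifs <;> simp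
  refine ⟨fun i => ?_, hn, fun i hi => by simp [extZero, not_lt.2 hi]⟩
  by_cases hi : i + 1 < r
  · have := hmu (show (⟨i, by omega⟩ : Fin r) ≤ ⟨i + 1, hi⟩ by simp)
    simpa [extZero, hi, show i < r by omega] using this
  · rw [show extZero mu (i + 1) = 0 by simp [extZero, hi]]
    exact hn i

/-- The chain from the empty partition to `κ` adding the rows of `κ` one by one. -/
def rowChain (κ : ℕ → ℤ) (k i : ℕ) : ℤ := if i < k then κ i else 0

theorem IsPart.isChainTo_rowChain {κ : ℕ → ℤ} (hκ : IsPart r κ) : IsChainTo r r κ (rowChain κ) := by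
  refine ⟨fun k hk => funext fun i => ?_, fun k _ i => ?_, fun k i => ?_, fun k i hi => ?_⟩
  · unfold rowChain
    split_ifs with h
    · rfl
    · exact (hκ.eq_zero i (by omega)).symm
  · have h1 := hκ.nonneg i
    have h2 := hκ.anti i
    unfold rowChain
    split_ifs <;> omega
  · have h1 := hκ.nonneg i
    unfold rowChain
    split_ifs <;> omega
  · simp [rowChain, hκ.eq_zero i hi]

theorem psum_rowChain_succ (κ : ℕ → ℤ) (k i : ℕ) :
    psum (rowChain κ (k + 1)) i - psum (rowChain κ k) i = if k < i then κ k else 0 := by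
  unfold _root_.psum
  rw [← Finset.sum_sub_distrib]
  have : ∀ j, rowChain κ (k + 1) j - rowChain κ k j = if k = j then κ k else 0 := by
    intro j
    rcases eq_or_ne k j with rfl | h
    · simp [rowChain]
    · unfold rowChain
      split_ifs <;> omega
  simp [this]

theorem IsPart.isLatticeChain_rowChain {κ : ℕ → ℤ} (hκ : IsPart r κ) :
    IsLatticeChain (rowChain κ) := by
  intro k i
  unfold latticeGap
  have h1 := hκ.nonneg k
  have h2 := hκ.anti k
  rw [psum_rowChain_succ, psum_rowChain_succ κ (k + 1)]
  split_ifs <;> omega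

theorem IsChainTo.eq_rowChain (hx : IsChainTo r n lam x) (hl : IsLatticeChain x)
    (h0 : ∀ i, x 0 i = 0) : x = rowChain lam := by
  have hz : ∀ k i, k ≤ i → x k i = 0 := by
    intro k
    induction k with
    | zero => exact fun i _ => h0 i
    | succ k ih =>
      intro i hi
      by_cases hk : k < n
      · obtain ⟨j, rfl⟩ : ∃ j, i = j + 1 := ⟨i - 1, by omega⟩
        have h1 := (hx.interl k hk j).2
        rw [ih j (by omega)] at h1
        exact le_antisymm h1 (hx.nonneg _ _)
      · rw [hx.last (k + 1) (by omega), ← hx.last k (by omega)]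
        exact ih i (by omega)
  funext k i
  unfold rowChain
  split_ifs with h
  · exact hx.eq_last hl h
  · exact hz k i (by omega)

open Classical in
theorem partCoeff_schurP_mul_alternant {nu : Fin r → ℕ} (hnu : Antitone nu) {κ : ℕ → ℤ}
    (hκ : IsPart r κ) :
    partCoeff r (schurP nu * alternant r) κ = if κ = extZero nu then 1 else 0 := by
  rw [(isAlternating_alternant r).partCoeff_schurP_mul_eq_sum hnu hκ]
  have h1 : ∀ x ∈ (chainFin r r κ).filter (fun x => IsLatticeChain x ∧ HasContent r nu x),
      partCoeff r (alternant r) (x 0) = if x = rowChain κ then 1 else 0 := by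
    intro x hx
    obtain ⟨hx1, hl, hc⟩ := Finset.mem_filter.1 hx
    rw [mem_chainFin] at hx1
    rw [partCoeff_alternant (hx1.isPart hκ 0)]
    refine if_congr ⟨fun h => hx1.eq_rowChain hl h, ?_⟩ rfl rfl
    rintro rfl i
    simp [rowChain]
  rw [Finset.sum_congr rfl h1, Finset.sum_ite_eq']
  refine if_congr ?_ rfl rfl
  rw [Finset.mem_filter, mem_chainFin]
  have hc : HasContent r nu (rowChain κ) ↔ κ = extZero nu := by
    unfold HasContent
    simp only [psum_rowChain_succ, Fin.is_lt, if_true]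
    refine ⟨fun h => funext fun i => ?_, fun h b => ?_⟩
    · by_cases hi : i < r
      · rw [h ⟨i, hi⟩]
        simp [extZero, hi]
      · rw [hκ.eq_zero i (by omega), (isPart_extZero hnu).eq_zero i (by omega)]
    · rw [h, extZero_val]
  rw [← hc]
  exact ⟨fun h => h.2.2, fun h => ⟨hκ.isChainTo_rowChain, hκ.isLatticeChain_rowChain, h⟩⟩

/-- The Littlewood–Richardson rule, qualitatively. -/
theorem lrCoeff_ne_zero_iff {lam mu nu : Fin r → ℕ} (hlam : Antitone lam) (hmu : Antitone mu)
    (hnu : Antitone nu) : lrCoeff r lam mu nu ≠ 0 ↔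
      ∃ x, IsChainTo r r (extZero lam) x ∧ IsLatticeChain x ∧ HasContent r mu x ∧
        x 0 = extZero nu := by
  classical
  have hpart := isPart_extZero hlam
  have h : lrCoeff r lam mu nu =
      partCoeff r (schurP mu * (schurP nu * alternant r)) (extZero lam) := by
    unfold lrCoeff schurCoeff partCoeff
    simp only [extZero_val, Int.toNat_natCast, mul_assoc]
  rw [h, ((isAlternating_alternant r).symm_mul (isSymmetric_schurP nu)).partCoeff_schurP_mul_eq_sum
    hmu hpart, Finset.sum_congr rfl fun x hx => partCoeff_schurP_mul_alternant hnu
      ((mem_chainFin.1 (Finset.mem_filter.1 hx).1).isPart hpart 0), Finset.sum_boole,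
    Nat.cast_ne_zero, Finset.card_ne_zero]
  constructor
  · rintro ⟨x, hx⟩
    obtain ⟨hx1, h0⟩ := Finset.mem_filter.1 hx
    obtain ⟨hx2, hl, hc⟩ := Finset.mem_filter.1 hx1
    exact ⟨x, mem_chainFin.1 hx2, hl, hc, h0⟩
  · rintro ⟨x, hx, hl, hc, h0⟩
    exact ⟨x, Finset.mem_filter.2 ⟨Finset.mem_filter.2 ⟨mem_chainFin.2 hx, hl, hc⟩, h0⟩⟩

end

/-! ### Littlewood–Richardson chains and hives -/

theorem isHive_iff {r : ℕ} {h : ℤ × ℤ → ℝ} : IsHive r h ↔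
    (∀ k i : ℕ, k ≤ i → i + 2 ≤ r → h (k, i) + h (k + 1, i + 2) ≤ h (k, i + 1) + h (k + 1, i + 1)) ∧
    (∀ k i : ℕ, k + 1 ≤ i → i + 1 ≤ r → h (k + 1, i) + h (k, i + 1) ≤ h (k, i) + h (k + 1, i + 1)) ∧
    ∀ k i : ℕ, k + 1 ≤ i → i + 1 ≤ r →
      h (k + 2, i + 1) + h (k, i) ≤ h (k + 1, i) + h (k + 1, i + 1) := by
  refine ⟨fun hh => ⟨fun k i h1 h2 => ?_, fun k i h1 h2 => ?_, fun k i h1 h2 => ?_⟩, ?_⟩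
  · have := hh (k, i + 1) 0 (by simp [InnerEdge, InTri, hexDir]; omega)
    simp [rhomb, hexDir, add_assoc] at this
    linarith
  · have := hh (k, i) 1 (by simp [InnerEdge, InTri, hexDir]; omega)
    simp [rhomb, hexDir] at this
    linarith
  · have := hh (k + 1, i) 2 (by simp [InnerEdge, InTri, hexDir]; omega)
    simp [rhomb, hexDir, add_assoc] at this
    linarith
  · rintro ⟨hA, hB, hC⟩
    have key : ∀ v, ∀ i : Fin 6, (i = 0 ∨ i = 1 ∨ i = 2) → InnerEdge r v i → 0 ≤ rhomb h v i := by
      rintro ⟨a, b⟩ i hi hv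
      rcases hi with rfl | rfl | rfl
      · simp [InnerEdge, InTri, hexDir] at hv
        obtain ⟨k, rfl⟩ := Int.eq_ofNat_of_zero_le (a := a) (by omega)
        obtain ⟨i, hi⟩ := Int.eq_ofNat_of_zero_le (a := b - 1) (by omega)
        obtain rfl : b = i + 1 := by omega
        have := hA k i (by omega) (by omega)
        simp [rhomb, hexDir, add_assoc]
        linarith
      · simp [InnerEdge, InTri, hexDir] at hv
        obtain ⟨k, rfl⟩ := Int.eq_ofNat_of_zero_le (a := a) (by omega)
        obtain ⟨i, rfl⟩ := Int.eq_ofNat_of_zero_le (a := b) (by omega)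
        have := hB k i (by omega) (by omega)
        simp [rhomb, hexDir]
        linarith
      · simp [InnerEdge, InTri, hexDir] at hv
        obtain ⟨k, hk⟩ := Int.eq_ofNat_of_zero_le (a := a - 1) (by omega)
        obtain ⟨i, rfl⟩ := Int.eq_ofNat_of_zero_le (a := b) (by omega)
        obtain rfl : a = k + 1 := by omega
        have := hC k i (by omega) (by omega)
        simp [rhomb, hexDir, add_assoc]
        linarith
    intro v i hv
    by_cases hi : i = 0 ∨ i = 1 ∨ i = 2
    · exact key v i hi hv
    · rw [← rhomb_opp]
      exact key _ _ ((by decide : ∀ i : Fin 6, ¬ (i = 0 ∨ i = 1 ∨ i = 2) →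
        (i + 3 = 0 ∨ i + 3 = 1 ∨ i + 3 = 2)) i hi) hv.opp

section

variable {r : ℕ} {mu nu : Fin r → ℕ} {lam : ℕ → ℤ} {x : ℕ → ℕ → ℤ}

theorem psum_extZero_succ (mu : Fin r → ℕ) {k : ℕ} (hk : k < r) :
    psum (extZero mu) (k + 1) = psum (extZero mu) k + mu ⟨k, hk⟩ := by
  rw [psum_succ, ← extZero_val]

theorem HasContent.psum_eq (h : HasContent r mu x) {k : ℕ} (hk : k ≤ r) :
    psum (x k) r = psum (x 0) r + psum (extZero mu) k := by
  induction k with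
  | zero => simp
  | succ k ih =>
    have h1 := h ⟨k, hk⟩
    have h2 := ih (by omega)
    rw [psum_extZero_succ mu hk]
    simp only at h1
    linarith

/-- The hive of partial sums of a Littlewood–Richardson chain, divided by `N`. -/
def chainHive (r N : ℕ) (x : ℕ → ℕ → ℤ) (v : ℤ × ℤ) : ℝ :=
  open Classical in if InTri r v then (psum (x v.1.toNat) v.2.toNat : ℝ) / N else 0

theorem chainHive_natCast (r N : ℕ) (x : ℕ → ℕ → ℤ) {k i : ℕ} (hk : k ≤ i) (hi : i ≤ r) :
    chainHive r N x (k, i) = (psum (x k) i : ℝ) / N := by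
  simp [chainHive, InTri, hk, hi]

theorem isHive_chainHive (N : ℕ) (hx : IsChainTo r r lam x) (hl : IsLatticeChain x) :
    IsHive r (chainHive r N x) := by
  have hN : (0 : ℝ) ≤ (N : ℝ)⁻¹ := by positivity
  have hdiv : ∀ a b c d : ℤ, a + b ≤ c + d → (a : ℝ) / N + b / N ≤ c / N + d / N := by
    intro a b c d h
    have h' : (a : ℝ) + b ≤ c + d := by exact_mod_cast h
    rw [← add_div, ← add_div]
    gcongr
  refine isHive_iff.2 ⟨fun k i h1 h2 => ?_, fun k i h1 h2 => ?_, fun k i h1 h2 => ?_⟩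
  · have e1 := chainHive_natCast r N x (k := k) (i := i) (by omega) (by omega)
    have e2 := chainHive_natCast r N x (k := k + 1) (i := i + 2) (by omega) (by omega)
    have e3 := chainHive_natCast r N x (k := k) (i := i + 1) (by omega) (by omega)
    have e4 := chainHive_natCast r N x (k := k + 1) (i := i + 1) (by omega) (by omega)
    push_cast at e1 e2 e3 e4
    rw [e1, e2, e3, e4]
    refine hdiv _ _ _ _ ?_
    have := (hx.interl k (by omega) i).2
    rw [psum_succ (x k), psum_succ (x (k + 1)) (i + 1)]
    linarith
  · have e1 := chainHive_natCast r N x (k := k + 1) (i := i) (by omega) (by omega)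
    have e2 := chainHive_natCast r N x (k := k) (i := i + 1) (by omega) (by omega)
    have e3 := chainHive_natCast r N x (k := k) (i := i) (by omega) (by omega)
    have e4 := chainHive_natCast r N x (k := k + 1) (i := i + 1) (by omega) (by omega)
    push_cast at e1 e2 e3 e4
    rw [e1, e2, e3, e4]
    refine hdiv _ _ _ _ ?_
    have := hx.le_succ k i
    rw [psum_succ (x k), psum_succ (x (k + 1))]
    linarith
  · have e1 := chainHive_natCast r N x (k := k + 2) (i := i + 1) (by omega) (by omega)
    have e2 := chainHive_natCast r N x (k := k) (i := i) (by omega) (by omega)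
    have e3 := chainHive_natCast r N x (k := k + 1) (i := i) (by omega) (by omega)
    have e4 := chainHive_natCast r N x (k := k + 1) (i := i + 1) (by omega) (by omega)
    push_cast at e1 e2 e3 e4
    rw [e1, e2, e3, e4]
    refine hdiv _ _ _ _ ?_
    have := hl k i
    unfold latticeGap at this
    linarith

theorem extZero_mul (N : ℕ) (mu : Fin r → ℕ) (i : ℕ) :
    extZero (fun a => N * mu a) i = N * extZero mu i := by
  unfold extZero
  split_ifs <;> simp

theorem psum_extZero_mul (N : ℕ) (mu : Fin r → ℕ) (i : ℕ) :
    psum (extZero fun a => N * mu a) i = N * psum (extZero mu) i := by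
  simp [psum, extZero_mul, Finset.mul_sum]

/-- A Littlewood–Richardson chain from `nu` to `lam` of content `mu`. -/
structure IsLRChain (lam mu nu : Fin r → ℕ) (x : ℕ → ℕ → ℤ) : Prop where
  chain : IsChainTo r r (extZero lam) x
  lattice : IsLatticeChain x
  content : HasContent r mu x
  first : x 0 = extZero nu

variable {lam mu nu : Fin r → ℕ}

theorem IsLRChain.chainHive_boundary {N : ℕ} (hN : 0 < N)
    (hx : IsLRChain (fun a => N * lam a) (fun a => N * mu a) (fun a => N * nu a) x) :
    (∀ i : ℕ, i ≤ r → chainHive r N x ((0 : ℕ), i) = psum (extZero nu) i) ∧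
    (∀ k : ℕ, k ≤ r → chainHive r N x (k, k) = psum (extZero lam) k) ∧
    ∀ k : ℕ, k ≤ r →
      chainHive r N x (k, r) = (psum (extZero nu) r + psum (extZero mu) k : ℤ) := by
  have hN' : (N : ℝ) ≠ 0 := by positivity
  refine ⟨fun i hi => ?_, fun k hk => ?_, fun k hk => ?_⟩
  · rw [chainHive_natCast r N x (Nat.zero_le i) hi, hx.first, psum_extZero_mul]
    push_cast
    field_simp
  · rw [chainHive_natCast r N x le_rfl hk, psum_congr fun j hj => hx.chain.eq_last hx.lattice hj,
      psum_extZero_mul]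
    push_cast
    field_simp
  · rw [chainHive_natCast r N x hk le_rfl, hx.content.psum_eq hk, hx.first, psum_extZero_mul,
      psum_extZero_mul]
    push_cast
    field_simp

theorem IsLRChain.chainHive_integral {N : ℕ} (hN : 0 < N)
    (hx : IsLRChain (fun a => N * lam a) (fun a => N * mu a) (fun a => N * nu a) x)
    (v : ℤ × ℤ) (hv : ¬ InInt r v) : ∃ n : ℤ, chainHive r N x v = n := by
  obtain ⟨h1, h2, h3⟩ := hx.chainHive_boundary hN
  by_cases ht : InTri r v
  · obtain ⟨a, b⟩ := v
    simp only [InTri, InInt] at ht hv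
    obtain ⟨k, rfl⟩ := Int.eq_ofNat_of_zero_le ht.1
    obtain ⟨i, rfl⟩ := Int.eq_ofNat_of_zero_le (ht.1.trans ht.2.1)
    rcases (by omega : k = 0 ∨ k = i ∨ i = r) with rfl | rfl | rfl
    · exact ⟨_, h1 i (by omega)⟩
    · exact ⟨_, h2 k (by omega)⟩
    · exact ⟨_, h3 k (by omega)⟩
  · exact ⟨0, by simp [chainHive, ht]⟩

theorem IsLRChain.mul (N : ℕ) (hx : IsLRChain lam mu nu x) :
    IsLRChain (fun a => N * lam a) (fun a => N * mu a) (fun a => N * nu a)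
      (fun k i => N * x k i) := by
  have hp : ∀ k i, psum (fun i => N * x k i) i = N * psum (x k) i := fun k i => by
    simp [psum, Finset.mul_sum]
  have hN : (0 : ℤ) ≤ N := by positivity
  refine ⟨⟨fun k hk => funext fun i => ?_, fun k hk i => ⟨?_, ?_⟩, fun k i => ?_, fun k i hi => ?_⟩,
    fun k i => ?_, fun b => ?_, funext fun i => ?_⟩
  · rw [extZero_mul, hx.chain.last k hk]
  · exact mul_le_mul_of_nonneg_left (hx.chain.interl k hk i).1 hN
  · exact mul_le_mul_of_nonneg_left (hx.chain.interl k hk i).2 hN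
  · exact mul_nonneg hN (hx.chain.nonneg k i)
  · rw [hx.chain.eq_zero k i hi, mul_zero]
  · have := mul_nonneg hN (hx.lattice k i)
    unfold latticeGap at *
    simp only [hp]
    linarith
  · have := hx.content b
    simp only [hp]
    rw [← mul_sub, this]
    push_cast
    rfl
  · rw [extZero_mul, hx.first]

theorem psum_eq_of_le {p : ℕ → ℤ} (hp : ∀ i, r ≤ i → p i = 0) {i : ℕ} (hi : r ≤ i) :
    psum p i = psum p r := by
  induction i, hi using Nat.le_induction with
  | base => rfl
  | succ i hi ih => rw [psum_succ, hp i hi, ih, add_zero]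

/-- The chain of differences of an integral hive. -/
def hiveChain (r : ℕ) (lam : ℕ → ℤ) (g : ℕ → ℕ → ℤ) (k i : ℕ) : ℤ :=
  if i < k then lam i else if i < r then g k (i + 1) - g k i else 0

theorem isLRChain_hiveChain (hlam : Antitone lam) (hmu : Antitone mu) {g : ℕ → ℕ → ℤ}
    (hA : ∀ k i : ℕ, k ≤ i → i + 2 ≤ r →
      g k i + g (k + 1) (i + 2) ≤ g k (i + 1) + g (k + 1) (i + 1))
    (hB : ∀ k i : ℕ, k + 1 ≤ i → i + 1 ≤ r →
      g (k + 1) i + g k (i + 1) ≤ g k i + g (k + 1) (i + 1))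
    (hC : ∀ k i : ℕ, k + 1 ≤ i → i + 1 ≤ r →
      g (k + 2) (i + 1) + g k i ≤ g (k + 1) i + g (k + 1) (i + 1))
    (h0 : ∀ i ≤ r, g 0 i = psum (extZero nu) i) (hd : ∀ k ≤ r, g k k = psum (extZero lam) k)
    (hr : ∀ k ≤ r, g k r = psum (extZero nu) r + psum (extZero mu) k) :
    IsLRChain lam mu nu (hiveChain r (extZero lam) g) := by
  have hlp := isPart_extZero hlam
  have hmp := isPart_extZero hmu
  have hlo : ∀ k i, i < k → hiveChain r (extZero lam) g k i = extZero lam i := fun k i h => by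
    simp [hiveChain, h]
  have hmid : ∀ k i, k ≤ i → i < r → hiveChain r (extZero lam) g k i = g k (i + 1) - g k i :=
    fun k i h h' => by simp [hiveChain, not_lt.2 h, h']
  have hhi : ∀ k i, r ≤ i → hiveChain r (extZero lam) g k i = 0 := fun k i h => by
    simp only [hiveChain, not_lt.2 h, if_false, hlp.eq_zero i h, ite_self]
  have hfirst : ∀ i, hiveChain r (extZero lam) g 0 i = extZero nu i := by
    intro i
    by_cases hi : i < r
    · rw [hmid 0 i (Nat.zero_le i) hi, h0 _ hi, h0 _ hi.le, psum_succ]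
      ring
    · rw [hhi 0 i (not_lt.1 hi)]
      simp [extZero, hi]
  have hps : ∀ k i, k ≤ i → i ≤ r → psum (hiveChain r (extZero lam) g k) i = g k i := by
    intro k i hk
    induction i, hk using Nat.le_induction with
    | base =>
      intro hi
      rw [hd k hi]
      exact psum_congr fun j hj => hlo k j hj
    | succ i hk ih =>
      intro hi
      rw [psum_succ, ih (by omega), hmid k i hk hi]
      ring
  have hnn : ∀ k i, 0 ≤ hiveChain r (extZero lam) g k i := by
    intro k i
    by_cases hir : i < r
    · induction k with
      | zero =>
        rw [hfirst]
        unfold extZero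
        split_ifs <;> simp
      | succ k ih =>
        by_cases hik : i < k + 1
        · rw [hlo _ _ hik]
          exact hlp.nonneg i
        · rw [hmid _ _ (by omega) hir] at ih ⊢
          have := hB k i (by omega) hir
          omega
    · rw [hhi k i (by omega)]
  have hdiag : ∀ m k, k + m + 1 = r → g k (k + 1) ≤ g (k + 1) (k + 1) := by
    intro m
    induction m with
    | zero =>
      intro k hk
      have h1 := hr k (by omega)
      have h2 := hr (k + 1) (by omega)
      have h3 := hmp.nonneg k
      rw [psum_succ] at h2
      rw [show k + 1 = r by omega] at *
      omega
    | succ m ih =>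
      intro k hk
      have := hC k (k + 1) le_rfl (by omega)
      have := ih (k + 1) (by omega)
      simp only [add_assoc, Nat.reduceAdd] at *
      omega
  refine ⟨⟨fun k hk => funext fun i => ?_, fun k hk i => ⟨?_, ?_⟩, hnn, hhi⟩, fun k i => ?_,
    fun b => ?_, funext hfirst⟩
  · by_cases hi : i < k
    · exact hlo k i hi
    · rw [hhi k i (by omega), hlp.eq_zero i (by omega)]
  · rcases lt_trichotomy i k with hi | rfl | hi
    · rw [hlo k i hi, hlo (k + 1) i (by omega)]
    · rw [hmid i i le_rfl hk, hlo (i + 1) i (by omega)]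
      have h1 := hdiag (r - i - 1) i (by omega)
      have h2 := hd (i + 1) hk
      rw [psum_succ] at h2
      have := hd i hk.le
      omega
    · by_cases hir : i < r
      · rw [hmid k i hi.le hir, hmid (k + 1) i hi hir]
        have := hB k i hi hir
        omega
      · rw [hhi k i (by omega), hhi (k + 1) i (by omega)]
  · by_cases hi : i < k
    · rw [hlo k i hi, hlo (k + 1) (i + 1) (by omega)]
      exact hlp.anti i
    · by_cases hir : i + 1 < r
      · rw [hmid k i (by omega) (by omega), hmid (k + 1) (i + 1) (by omega) hir]
        have := hA k i (by omega) hir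
        simp only [add_assoc, Nat.reduceAdd] at *
        omega
      · rw [hhi (k + 1) (i + 1) (by omega)]
        exact hnn k i
  · by_cases hik : i ≤ k
    · have h1 : psum (hiveChain r (extZero lam) g (k + 1)) i =
          psum (hiveChain r (extZero lam) g k) i :=
        psum_congr fun j hj => by rw [hlo _ _ (by omega), hlo _ _ (by omega)]
      have h2 : psum (hiveChain r (extZero lam) g (k + 2)) (i + 1) =
          psum (hiveChain r (extZero lam) g (k + 1)) (i + 1) :=
        psum_congr fun j hj => by rw [hlo _ _ (by omega), hlo _ _ (by omega)]
      unfold latticeGap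
      linarith
    · by_cases hir : i + 1 ≤ r
      · have := hC k i (by omega) hir
        unfold latticeGap
        rw [hps _ _ (by omega) (by omega), hps _ _ (by omega) (by omega),
          hps _ _ (by omega) (by omega), hps _ _ (by omega) (by omega)]
        linarith
      · have hsat : ∀ k i, r ≤ i → psum (hiveChain r (extZero lam) g k) i =
            psum (hiveChain r (extZero lam) g k) r := fun k _ => psum_eq_of_le (hhi k)
        have hfull : ∀ k, psum (hiveChain r (extZero lam) g k) r =
            psum (extZero nu) r + psum (extZero mu) k := by
          intro k
          by_cases hk : k ≤ r
          · rw [hps k r hk le_rfl, hr k hk]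
          · rw [psum_eq_of_le hmp.eq_zero (not_le.1 hk).le, ← hr r le_rfl, ← hps r r le_rfl le_rfl]
            exact psum_congr fun j hj => by rw [hlo _ _ (by omega), hlo _ _ hj]
        have := hmp.anti k
        unfold latticeGap
        rw [hsat _ i (by omega), hsat _ i (by omega), hsat _ (i + 1) (by omega),
          hsat _ (i + 1) (by omega), hfull, hfull, hfull, psum_succ _ (k + 1), psum_succ _ k]
        linarith
  · rw [hps _ _ (by omega) le_rfl, hps _ _ (by omega) le_rfl, hr _ (by omega), hr _ (by omega),
      psum_extZero_succ mu b.2]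
    ring

theorem exists_isLRChain_of_mul {N : ℕ} (hN : 0 < N) (hlam : Antitone lam) (hmu : Antitone mu)
    (hx : IsLRChain (fun a => N * lam a) (fun a => N * mu a) (fun a => N * nu a) x) :
    ∃ y, IsLRChain lam mu nu y := by
  obtain ⟨h, ⟨hh, hb⟩, hint⟩ := exists_integral_hive
    (isHive_chainHive N hx.chain hx.lattice) (hx.chainHive_integral hN)
  choose g hg using hint
  obtain ⟨hA, hB, hC⟩ := isHive_iff.1 hh
  obtain ⟨h1, h2, h3⟩ := hx.chainHive_boundary hN
  simp only [hg] at hA hB hC hb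
  refine ⟨_, isLRChain_hiveChain (g := fun k i => g (k, i)) hlam hmu ?_ ?_ ?_ ?_ ?_ ?_⟩
  · intro k i hk hi
    exact_mod_cast hA k i hk hi
  · intro k i hk hi
    exact_mod_cast hB k i hk hi
  · intro k i hk hi
    exact_mod_cast hC k i hk hi
  · intro i hi
    have := hb ((0 : ℕ), i) (by simp [InInt])
    rw [h1 i hi] at this
    exact_mod_cast this
  · intro k hk
    have := hb (k, k) (by simp [InInt])
    rw [h2 k hk] at this
    exact_mod_cast this
  · intro k hk
    have := hb (k, r) (by simp [InInt])
    rw [h3 k hk] at this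
    exact_mod_cast this

end

/-- the saturation theorem of Knutson–Tao.  For partitions
`λ, μ, ν` with at most `r` parts and a positive integer `N`, the
Littlewood–Richardson coefficient `c^λ_{μ,ν}` is nonzero iff `c^{Nλ}_{Nμ,Nν}` is. -/
theorem stmt3 (r N : ℕ) (hN : 0 < N) (lam mu nu : Fin r → ℕ)
    (hlam : Antitone lam) (hmu : Antitone mu) (hnu : Antitone nu) :
    lrCoeff r lam mu nu ≠ 0 ↔
      lrCoeff r (fun a => N * lam a) (fun a => N * mu a) (fun a => N * nu a) ≠ 0 := by
  have hmono : ∀ {p : Fin r → ℕ}, Antitone p → Antitone fun a => N * p a :=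
    fun hp _ _ hab => Nat.mul_le_mul_left N (hp hab)
  rw [lrCoeff_ne_zero_iff hlam hmu hnu, lrCoeff_ne_zero_iff (hmono hlam) (hmono hmu) (hmono hnu)]
  constructor
  · rintro ⟨x, h1, h2, h3, h4⟩
    obtain ⟨h1, h2, h3, h4⟩ := (IsLRChain.mk h1 h2 h3 h4).mul N
    exact ⟨_, h1, h2, h3, h4⟩
  · rintro ⟨x, h1, h2, h3, h4⟩
    obtain ⟨y, h1, h2, h3, h4⟩ := exists_isLRChain_of_mul hN hlam hmu (IsLRChain.mk h1 h2 h3 h4)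
    exact ⟨y, h1, h2, h3, h4⟩

end
end

section
/- Let W be an n-dimensional vector space, E_• a complete flag on W, and S ⊆ V ⊆ W subspaces with dim(V)=r and dim(S)=d. Let I be the unique subset of [n] of cardinality r with V ∈ Ω°_I(E_•) ⊆ Gr(r,W), and let K be the unique subset of [r] of cardinality d with S ∈ Ω°_K(E_•(V)) ⊆ Gr(d,V). Set L = {i_a : a ∈ K}. Then S ∈ Ω°_L(E_•) ⊆ Gr(d,W). -/
noncomputable section

open Module Submodule

/-- A member `V ∩ E_u` of the restricted chain is the member of the induced flag indexed by
its dimension. -/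
theorem indSub_finrank_comap {k M : Type*} [Field k] [AddCommGroup M] [Module k M]
    [FiniteDimensional k M] {E : ℕ → Submodule k M} (hE : Monotone E)
    (V : Submodule k M) (u : ℕ) :
    indSub E V (finrank k ↥(Submodule.comap V.subtype (E u))) =
      Submodule.comap V.subtype (E u) := by
  refine le_antisymm (iInf₂_le u (le_refl (finrank k ↥(Submodule.comap V.subtype (E u)))))
    (le_iInf₂ fun w hw => ?_)
  rcases le_total u w with h | h
  · exact Submodule.comap_mono (hE h)
  · exact (Submodule.eq_of_le_of_finrank_le (Submodule.comap_mono (hE h)) hw).ge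

/-- The dimension of the restriction of a subspace to `V` is that of its intersection with `V`. -/
theorem finrank_comap_subtype_eq {k M : Type*} [Field k] [AddCommGroup M] [Module k M]
    (V T : Submodule k M) :
    finrank k ↥(Submodule.comap V.subtype T) = finrank k ↥(V ⊓ T) := by
  rw [← Submodule.map_comap_subtype, Submodule.finrank_map_subtype_eq]

/-- For a strictly increasing tuple, `i_b ≤ u` if and only if `b` is smaller than the number
of entries that are at most `u`. -/
theorem StrictMono.lt_card_filter_iff {n r : ℕ} {i : Fin r → Fin n} (hi : StrictMono i)
    (u : ℕ) (b : Fin r) :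
    (b : ℕ) + 1 ≤ (Finset.univ.filter (fun a : Fin r => (i a : ℕ) + 1 ≤ u)).card ↔
      (i b : ℕ) + 1 ≤ u := by
  constructor
  · intro h
    by_contra hb
    have hsub : Finset.univ.filter (fun a : Fin r => (i a : ℕ) + 1 ≤ u) ⊆ Finset.Iio b := by
      intro a ha
      simp only [Finset.mem_filter, Finset.mem_univ, true_and] at ha
      rw [Finset.mem_Iio]
      by_contra hab
      have : (i b : ℕ) ≤ i a := hi.monotone (not_lt.mp hab)
      omega
    have := Finset.card_le_card hsub
    rw [Fin.card_Iio] at this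
    omega
  · intro h
    have hsub : Finset.Iic b ⊆ Finset.univ.filter (fun a : Fin r => (i a : ℕ) + 1 ≤ u) := by
      intro a ha
      have : (i a : ℕ) ≤ i b := hi.monotone (Finset.mem_Iic.mp ha)
      simp only [Finset.mem_filter, Finset.mem_univ, true_and]
      omega
    simpa using Finset.card_le_card hsub

/-- Lemma `falcon`.  If `S ⊆ V ⊆ W`, `dim V = r`, `dim S = d`,
`V ∈ Ω°_I(E_•) ⊆ Gr(r,W)` and `S ∈ Ω°_K(E_•(V)) ⊆ Gr(d,V)` for the induced flag on `V`,
then `S ∈ Ω°_L(E_•) ⊆ Gr(d,W)` where `L = {i_a : a ∈ K}`. -/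
theorem stmt5 (k : Type) [Field k] [IsAlgClosed k]
    {W : Type} [AddCommGroup W] [Module k W] [FiniteDimensional k W]
    (n r d : ℕ) (hW : Module.finrank k W = n)
    (E : ℕ → Submodule k W) (hE : IsFlag E)
    (S V : Submodule k W) (hSV : S ≤ V)
    (hVr : Module.finrank k ↥V = r) (hSd : Module.finrank k ↥S = d)
    (I : Fin r → Fin n) (hI : StrictMono I) (hV : cellMem I E V)
    (K : Fin d → Fin r) (hK : StrictMono K)
    (hS : cellMem K (indSub E V) (Submodule.comap V.subtype S)) :
    cellMem (fun t => I (K t)) E S := by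
  refine ⟨hSd, fun u hu => ?_⟩
  have hdim := finrank_comap_subtype_eq V (E u)
  have hle : finrank k ↥(Submodule.comap V.subtype (E u)) ≤ r :=
    hVr ▸ Submodule.finrank_le _
  have h := hS.2 _ hle
  rw [indSub_finrank_comap hE.1, ← Submodule.comap_inf, finrank_comap_subtype_eq,
    inf_eq_right.mpr (inf_le_left.trans hSV), hdim, hV.2 u hu] at h
  simpa only [hI.lt_card_filter_iff] using h

end
end
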